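/- arXiv:1910.07228 — 7 statements merged into one kernel-verified Lean document; each statement's English description precedes it below -/
import Mathlib

section
/- In the soliton matrix setup, for any ζ ∈ ℂ such that L₁ − ζ, L₁ + ζ, L₂ − ζ, L₂ + ζ are invertible and 1 − β₁ζℓ₁ ≠ 0 and 1 − β₂ζℓ₂ ≠ 0, the shifted tau-function satisfies τ^ζ = τ·(1 + 2ζ·K₁ζ·β₁ζ·A₁G₂A₂·ℓ₁ζ) and also τ^ζ = τ·(1 − 2ζ·K₂ζ·β₂ζ·A₂G₁A₁·ℓ₂ζ), where τ^ζ = det(1 + A₁^ζ A₂^ζ). -/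
open Matrix

noncomputable section

/-! Soliton matrix setup (Vekslerchik, "Solitons of the vector KdV and Yamilov lattices").
We work with `N × N` complex matrices.  `Dg l` is the diagonal matrix with entries `l`.
The `ζ`-shift acts by `A₁ ↦ A₁(L₁ + ζ)(L₁ − ζ)⁻¹`, `A₂ ↦ A₂(L₂ − ζ)(L₂ + ζ)⁻¹`;
all derived quantities (`tauD`, `G₁D`, `pD`, …) are functions of the pair `(A₁, A₂)`,
so their shifted values are obtained by evaluating them on the shifted matrices. -/

/-- `N × N` complex matrices. -/
abbrev Mat (N : ℕ) := Matrix (Fin N) (Fin N) ℂ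

variable {N : ℕ}

/-- the diagonal matrix built from `l`. -/
def Dg (l : Fin N → ℂ) : Mat N := Matrix.diagonal l

/-- the `ζ`-shift of `A₁`: `A₁(L₁ + ζ)(L₁ − ζ)⁻¹`. -/
def shA₁ (l₁ : Fin N → ℂ) (ζ : ℂ) (A₁ : Mat N) : Mat N :=
  A₁ * (Dg l₁ + ζ • 1) * (Dg l₁ - ζ • 1)⁻¹

/-- the `ζ`-shift of `A₂`: `A₂(L₂ − ζ)(L₂ + ζ)⁻¹`. -/
def shA₂ (l₂ : Fin N → ℂ) (ζ : ℂ) (A₂ : Mat N) : Mat N :=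
  A₂ * (Dg l₂ - ζ • 1) * (Dg l₂ + ζ • 1)⁻¹

/-- the tau-function `τ = det(1 + A₁A₂)`. -/
def tauD (A₁ A₂ : Mat N) : ℂ := (1 + A₁ * A₂).det

/-- `G₁ = (1 + A₁A₂)⁻¹`. -/
def G₁D (A₁ A₂ : Mat N) : Mat N := (1 + A₁ * A₂)⁻¹

/-- `G₂ = (1 + A₂A₁)⁻¹`. -/
def G₂D (A₁ A₂ : Mat N) : Mat N := (1 + A₂ * A₁)⁻¹

/-- `p = 1 − β₁G₁ℓ₁`. -/
def pD (β₁ ℓ₁ : Fin N → ℂ) (A₁ A₂ : Mat N) : ℂ := 1 - β₁ ⬝ᵥ (G₁D A₁ A₂ *ᵥ ℓ₁)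

/-- `q = β₁G₁A₁ℓ₂`. -/
def qD (β₁ ℓ₂ : Fin N → ℂ) (A₁ A₂ : Mat N) : ℂ := β₁ ⬝ᵥ (G₁D A₁ A₂ *ᵥ (A₁ *ᵥ ℓ₂))

/-- `r = β₂G₂A₂ℓ₁`. -/
def rD (β₂ ℓ₁ : Fin N → ℂ) (A₁ A₂ : Mat N) : ℂ := β₂ ⬝ᵥ (G₂D A₁ A₂ *ᵥ (A₂ *ᵥ ℓ₁))

/-- `s = 1 − β₂G₂ℓ₂`. -/
def sD (β₂ ℓ₂ : Fin N → ℂ) (A₁ A₂ : Mat N) : ℂ := 1 - β₂ ⬝ᵥ (G₂D A₁ A₂ *ᵥ ℓ₂)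

/-- the row `β₁ζ = β₁(L₂ − ζ)⁻¹`. -/
def β₁z (l₂ β₁ : Fin N → ℂ) (ζ : ℂ) : Fin N → ℂ := β₁ ᵥ* (Dg l₂ - ζ • 1)⁻¹

/-- the row `β₂ζ = β₂(L₁ + ζ)⁻¹`. -/
def β₂z (l₁ β₂ : Fin N → ℂ) (ζ : ℂ) : Fin N → ℂ := β₂ ᵥ* (Dg l₁ + ζ • 1)⁻¹

/-- the column `ℓ₁ζ = (L₂ + ζ)⁻¹ℓ₁`. -/
def ℓ₁z (l₂ ℓ₁ : Fin N → ℂ) (ζ : ℂ) : Fin N → ℂ := (Dg l₂ + ζ • 1)⁻¹ *ᵥ ℓ₁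

/-- the column `ℓ₂ζ = (L₁ − ζ)⁻¹ℓ₂`. -/
def ℓ₂z (l₁ ℓ₂ : Fin N → ℂ) (ζ : ℂ) : Fin N → ℂ := (Dg l₁ - ζ • 1)⁻¹ *ᵥ ℓ₂

/-- `K₁ζ = (1 − β₁ζℓ₁)⁻¹`. -/
def K₁z (l₂ β₁ ℓ₁ : Fin N → ℂ) (ζ : ℂ) : ℂ := (1 - β₁z l₂ β₁ ζ ⬝ᵥ ℓ₁)⁻¹

/-- `K₂ζ = (1 − β₂ζℓ₂)⁻¹`. -/
def K₂z (l₁ β₂ ℓ₂ : Fin N → ℂ) (ζ : ℂ) : ℂ := (1 - β₂z l₁ β₂ ζ ⬝ᵥ ℓ₂)⁻¹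

/-- `K_ζ = K₁ζ K₂ζ`. -/
def Kz (l₁ l₂ β₁ β₂ ℓ₁ ℓ₂ : Fin N → ℂ) (ζ : ℂ) : ℂ :=
  K₁z l₂ β₁ ℓ₁ ζ * K₂z l₁ β₂ ℓ₂ ζ

/-- `p_ζ = 1 − β₁ζG₁ℓ₁` (the `G`'s computed from the given pair `(A₁, A₂)`). -/
def pz (l₂ β₁ ℓ₁ : Fin N → ℂ) (ζ : ℂ) (A₁ A₂ : Mat N) : ℂ :=
  1 - β₁z l₂ β₁ ζ ⬝ᵥ (G₁D A₁ A₂ *ᵥ ℓ₁)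

/-- `q_ζ = β₁ζG₁A₁ℓ₂`. -/
def qz (l₂ β₁ ℓ₂ : Fin N → ℂ) (ζ : ℂ) (A₁ A₂ : Mat N) : ℂ :=
  β₁z l₂ β₁ ζ ⬝ᵥ (G₁D A₁ A₂ *ᵥ (A₁ *ᵥ ℓ₂))

/-- `r_ζ = β₂ζG₂A₂ℓ₁`. -/
def rz (l₁ β₂ ℓ₁ : Fin N → ℂ) (ζ : ℂ) (A₁ A₂ : Mat N) : ℂ :=
  β₂z l₁ β₂ ζ ⬝ᵥ (G₂D A₁ A₂ *ᵥ (A₂ *ᵥ ℓ₁))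

/-- `s_ζ = 1 − β₂ζG₂ℓ₂`. -/
def sz (l₁ β₂ ℓ₂ : Fin N → ℂ) (ζ : ℂ) (A₁ A₂ : Mat N) : ℂ :=
  1 - β₂z l₁ β₂ ζ ⬝ᵥ (G₂D A₁ A₂ *ᵥ ℓ₂)

end

theorem aux_S {N : ℕ} (P Q Pi Qi E : Mat N) (z K x : ℂ)
    (hPQ : P = Q + (2 * z) • 1) (hP1 : Pi * P = 1) (hQ : Q * Qi = 1)
    (hE : E * E = x • E) (hK : K * (1 - x) = 1) :
    Q * Pi * ((P - E * Q) * Qi * (1 + K • E)) = 1 + (2 * z * K) • (Pi * E) := by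
  have hP2 : P * Pi = 1 := mul_eq_one_comm.mp hP1
  have hc : Q * Pi = Pi * Q := by
    have h1 : Q = P - (2 * z) • 1 := by rw [hPQ]; simp
    rw [h1, sub_mul, mul_sub, hP1, hP2]; simp
  have hPiQ : Pi * Q = 1 - (2 * z) • Pi := by
    have h1 : Q = P - (2 * z) • 1 := by rw [hPQ]; simp
    rw [h1, mul_sub, hP1]; simp
  have e1 : Q * Pi * ((P - E * Q) * Qi * (1 + K • E))
      = (1 - Pi * Q * E) * (1 + K • E) := by
    have : Q * Pi * ((P - E * Q) * Qi) = 1 - Pi * Q * E := by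
      calc Q * Pi * ((P - E * Q) * Qi) = Q * (Pi * P) * Qi - Q * Pi * E * (Q * Qi) := by
            noncomm_ring
        _ = _ := by rw [hP1, hQ, hc]; simp [hQ]
    rw [← this]; noncomm_ring
  have hK' : 1 + K * x = K := by linear_combination -hK
  have e2 : E * (1 + K • E) = K • E := by
    rw [mul_add, mul_one, mul_smul_comm, hE, smul_smul]
    nth_rewrite 1 [← one_smul ℂ E]
    rw [← add_smul, hK']
  have e3 : (1 - Pi * Q * E) * (1 + K • E) =
      1 + K • E - Pi * Q * (E * (1 + K • E)) := by
    rw [sub_mul, one_mul, mul_assoc]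
  rw [e1, e3, e2, hPiQ]
  simp only [sub_mul, one_mul, smul_mul_assoc, mul_smul_comm, smul_sub, smul_smul]
  rw [mul_comm (2 * z) K]
  abel

theorem aux_half {N : ℕ} (l₁ l₂ ℓ β : Fin N → ℂ) (A B : Mat N)
    (h1 : (Dg l₂ - Matrix.vecMulVec ℓ β) * A = A * Dg l₁)
    (hG : IsUnit (1 + A * B)) (z : ℂ)
    (hζ1 : IsUnit (Dg l₁ - z • (1 : Mat N)))
    (hζ3 : IsUnit (Dg l₂ - z • (1 : Mat N))) (hζ4 : IsUnit (Dg l₂ + z • (1 : Mat N)))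
    (hK1 : 1 - β₁z l₂ β z ⬝ᵥ ℓ ≠ 0) :
    tauD (shA₁ l₁ z A) (shA₂ l₂ z B)
      = tauD A B * (1 + 2 * z * K₁z l₂ β ℓ z *
          (β₁z l₂ β z ⬝ᵥ ((A * G₂D A B * B) *ᵥ ℓ₁z l₂ ℓ z))) := by
  unfold tauD shA₁ shA₂ K₁z G₂D ℓ₁z
  set P := Dg l₂ + z • (1 : Mat N) with hP
  set Q := Dg l₂ - z • (1 : Mat N) with hQ
  set R := Dg l₁ + z • (1 : Mat N) with hR
  set T := Dg l₁ - z • (1 : Mat N) with hT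
  set b := β₁z l₂ β z with hb
  set E : Mat N := vecMulVec ℓ b with hE
  set x := b ⬝ᵥ ℓ with hx
  have hPi : P⁻¹ * P = 1 := nonsing_inv_mul _ ((isUnit_iff_isUnit_det _).1 hζ4)
  have hQi : Q * Q⁻¹ = 1 := mul_nonsing_inv _ ((isUnit_iff_isUnit_det _).1 hζ3)
  have hQi' : Q⁻¹ * Q = 1 := nonsing_inv_mul _ ((isUnit_iff_isUnit_det _).1 hζ3)
  have hTi : T * T⁻¹ = 1 := mul_nonsing_inv _ ((isUnit_iff_isUnit_det _).1 hζ1)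
  have hEQ : E * Q = vecMulVec ℓ β := by
    rw [hE, vecMulVec_mul, hb, β₁z, vecMul_vecMul, ← hQ, hQi', vecMul_one]
  have hEE : E * E = x • E := by
    rw [hE, vecMulVec_mul_vecMulVec, vecMulVec_smul]
  have hKx : (1 - x)⁻¹ * (1 - x) = 1 := inv_mul_cancel₀ hK1
  set K := (1 - x)⁻¹ with hK
  have hAR : A * R = (P - E * Q) * A := by
    rw [hEQ, hR, mul_add, ← h1, hP]; simp [add_mul, sub_mul]; abel
  have hAT : (Q - E * Q) * A = A * T := by
    rw [hEQ, hT, mul_sub, ← h1, hQ]; simp [sub_mul]; abel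
  have hinv : (1 + K • E) * (1 - E) = 1 := by
    have : (1 + K • E) * (1 - E) = 1 + (K * (1 - x) - 1) • E := by
      simp only [add_mul, mul_sub, one_mul, mul_one, smul_mul_assoc, hEE, smul_smul, sub_smul,
        mul_sub, one_smul]
      abel
    rw [this, hKx]; simp
  have hATi : A * T⁻¹ = Q⁻¹ * (1 + K • E) * A := by
    calc A * T⁻¹ = Q⁻¹ * ((1 + K • E) * (1 - E)) * Q * (A * T⁻¹) := by
          rw [hinv, mul_one, hQi', one_mul]
      _ = Q⁻¹ * (1 + K • E) * ((Q - E * Q) * A) * T⁻¹ := by noncomm_ring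
      _ = Q⁻¹ * (1 + K • E) * A * (T * T⁻¹) := by rw [hAT]; simp only [mul_assoc]
      _ = _ := by rw [hTi, mul_one]
  have hS := aux_S P Q P⁻¹ Q⁻¹ E z K x (by rw [hP, hQ, two_mul, add_smul]; abel) hPi hQi hEE hKx
  have hRT : A * R * T⁻¹ = (P - E * Q) * Q⁻¹ * (1 + K • E) * A := by
    rw [hAR, mul_assoc, hATi]; simp only [mul_assoc]
  have hd : (1 + A * R * T⁻¹ * (B * Q * P⁻¹)).det
      = (1 + A * B + vecMulVec ((2 * z * K) • (P⁻¹ *ᵥ ℓ)) (b ᵥ* (A * B))).det := by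
    have : A * R * T⁻¹ * (B * Q * P⁻¹) =
       ((P - E * Q) * Q⁻¹ * (1 + K • E) * A * B) * (Q * P⁻¹) := by
      rw [hRT]; simp only [mul_assoc]
    rw [this, det_one_add_mul_comm]
    congr 1
    have : Q * P⁻¹ * ((P - E * Q) * Q⁻¹ * (1 + K • E) * A * B) =
      (Q * P⁻¹ * ((P - E * Q) * Q⁻¹ * (1 + K • E))) * (A * B) := by simp only [mul_assoc]
    rw [this, hS, smul_vecMulVec, ← vecMulVec_mul, ← mul_vecMulVec, ← hE, add_mul, one_mul,
      smul_mul_assoc, add_assoc]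
  have hdet : IsUnit (1 + A * B).det := (isUnit_iff_isUnit_det _).1 hG
  have hG2 : IsUnit (1 + B * A).det := by rw [det_one_add_mul_comm]; exact hdet
  have hcom : A * (1 + B * A)⁻¹ * B = A * B * (1 + A * B)⁻¹ := by
    have e : (1 + B * A) * B = B * (1 + A * B) := by noncomm_ring
    have : (1 + B * A)⁻¹ * B = B * (1 + A * B)⁻¹ := by
      calc (1 + B * A)⁻¹ * B = (1 + B * A)⁻¹ * (B * (1 + A * B)) * (1 + A * B)⁻¹ := by
            simp only [mul_assoc]; rw [mul_nonsing_inv _ hdet, mul_one]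
        _ = _ := by rw [← e, ← mul_assoc, nonsing_inv_mul _ hG2, one_mul]
    rw [mul_assoc, this, mul_assoc]
  have hrank : ∀ u v : Fin N → ℂ, (1 + A * B + vecMulVec u v).det
      = (1 + A * B).det * (1 + v ⬝ᵥ ((1 + A * B)⁻¹ *ᵥ u)) := by
    intro u v
    have e : 1 + A * B + vecMulVec u v
        = (1 + A * B) * (1 + vecMulVec ((1 + A * B)⁻¹ *ᵥ u) v) := by
      rw [mul_add, mul_one, mul_vecMulVec, mulVec_mulVec, mul_nonsing_inv _ hdet, one_mulVec]
    rw [e, det_mul, vecMulVec_eq Unit, det_one_add_replicateCol_mul_replicateRow]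
  rw [hd, hrank, hcom]
  simp only [← mulVec_mulVec, mulVec_smul, dotProduct_smul, dotProduct_mulVec, vecMul_vecMul, smul_eq_mul]

/-- one-shift formulae for the tau-function:
`τ^ζ = τ·(1 + 2ζK₁ζ·β₁ζA₁G₂A₂ℓ₁ζ)` and `τ^ζ = τ·(1 − 2ζK₂ζ·β₂ζA₂G₁A₁ℓ₂ζ)`. -/
theorem soliton_one_shift_tau {N : ℕ} (hN : 1 ≤ N)
    (l₁ l₂ ℓ₁ ℓ₂ β₁ β₂ : Fin N → ℂ) (A₁ A₂ : Mat N)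
    (h1 : (Dg l₂ - Matrix.vecMulVec ℓ₁ β₁) * A₁ = A₁ * Dg l₁)
    (h2 : (Dg l₁ - Matrix.vecMulVec ℓ₂ β₂) * A₂ = A₂ * Dg l₂)
    (hG : IsUnit (1 + A₁ * A₂))
    (ζ : ℂ)
    (hζ1 : IsUnit (Dg l₁ - ζ • (1 : Mat N))) (hζ2 : IsUnit (Dg l₁ + ζ • (1 : Mat N)))
    (hζ3 : IsUnit (Dg l₂ - ζ • (1 : Mat N))) (hζ4 : IsUnit (Dg l₂ + ζ • (1 : Mat N)))
    (hK1 : 1 - β₁z l₂ β₁ ζ ⬝ᵥ ℓ₁ ≠ 0) (hK2 : 1 - β₂z l₁ β₂ ζ ⬝ᵥ ℓ₂ ≠ 0) :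
    tauD (shA₁ l₁ ζ A₁) (shA₂ l₂ ζ A₂)
      = tauD A₁ A₂ * (1 + 2 * ζ * K₁z l₂ β₁ ℓ₁ ζ *
          (β₁z l₂ β₁ ζ ⬝ᵥ ((A₁ * G₂D A₁ A₂ * A₂) *ᵥ ℓ₁z l₂ ℓ₁ ζ)))
    ∧ tauD (shA₁ l₁ ζ A₁) (shA₂ l₂ ζ A₂)
      = tauD A₁ A₂ * (1 - 2 * ζ * K₂z l₁ β₂ ℓ₂ ζ *
          (β₂z l₁ β₂ ζ ⬝ᵥ ((A₂ * G₁D A₁ A₂ * A₁) *ᵥ ℓ₂z l₁ ℓ₂ ζ))) := by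
  refine ⟨aux_half l₁ l₂ ℓ₁ β₁ A₁ A₂ h1 hG ζ hζ1 hζ3 hζ4 hK1, ?_⟩
  have hG' : IsUnit (1 + A₂ * A₁) := by
    rw [isUnit_iff_isUnit_det] at hG ⊢
    rwa [det_one_add_mul_comm]
  have eb : β₁z l₁ β₂ (-ζ) = β₂z l₁ β₂ ζ := by simp [β₁z, β₂z]
  have el : ℓ₁z l₁ ℓ₂ (-ζ) = ℓ₂z l₁ ℓ₂ ζ := by simp [ℓ₁z, ℓ₂z, sub_eq_add_neg]
  have eK : K₁z l₁ β₂ ℓ₂ (-ζ) = K₂z l₁ β₂ ℓ₂ ζ := by simp [K₁z, K₂z, eb]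
  have eA : shA₁ l₂ (-ζ) A₂ = shA₂ l₂ ζ A₂ := by simp [shA₁, shA₂, sub_eq_add_neg]
  have eB : shA₂ l₁ (-ζ) A₁ = shA₁ l₁ ζ A₁ := by simp [shA₁, shA₂, sub_eq_add_neg]
  have ht : ∀ X Y : Mat N, tauD X Y = tauD Y X := fun X Y => det_one_add_mul_comm X Y
  have key := aux_half l₂ l₁ ℓ₂ β₂ A₂ A₁ h2 hG' (-ζ)
    (by simpa using hζ4) (by simpa using hζ2) (by simpa [sub_eq_add_neg] using hζ1)
    (by rw [eb]; exact hK2)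
  rw [eb, el, eK, eA, eB] at key
  rw [ht, key, ht A₂ A₁]
  have eG : G₂D A₂ A₁ = G₁D A₁ A₂ := rfl
  rw [eG]
  ring
end

section
/- In the soliton matrix setup, for any ζ ∈ ℂ such that L₁ − ζ, L₁ + ζ, L₂ − ζ, L₂ + ζ are invertible, 1 − β₁ζℓ₁ ≠ 0, 1 − β₂ζℓ₂ ≠ 0, and 1 + A₁^ζ A₂^ζ is invertible, the shifted Green matrices satisfy (τ^ζ/τ)·( (1 + A₁^ζ A₂^ζ)⁻¹ − G₁ ) = 2ζ·K₂ζ·G₁A₁·ℓ₂ζ·β₂ζ·G₂A₂ and (τ^ζ/τ)·( (1 + A₂^ζ A₁^ζ)⁻¹ − G₂ ) = −2ζ·K₁ζ·G₂A₂·ℓ₁ζ·β₁ζ·G₁A₁, where τ^ζ = det(1 + A₁^ζ A₂^ζ). -/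
open Matrix

/-- The product of shifted matrices is a rank-one perturbation. -/
theorem rank_one_shift {N : ℕ} (Dp Dm Ep Em A B : Mat N) (l b : Fin N → ℂ) (c : ℂ)
    (hDp : IsUnit Dp) (hDm : IsUnit Dm) (hEp : IsUnit Ep)
    (hD : Dp = Dm + c • 1) (hE : Ep = Em + c • 1)
    (h : (Dp - Matrix.vecMulVec l b) * B = B * Ep)
    (hk : 1 - (b ᵥ* Dp⁻¹) ⬝ᵥ l ≠ 0) :
    A * Dp * Dm⁻¹ * (B * Em * Ep⁻¹) = A * B -
      (c * (1 - (b ᵥ* Dp⁻¹) ⬝ᵥ l)⁻¹) •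
        Matrix.vecMulVec (A *ᵥ (Dm⁻¹ *ᵥ l)) ((b ᵥ* Dp⁻¹) ᵥ* B) := by
  have hDp' := (Matrix.isUnit_iff_isUnit_det _).1 hDp
  have hDm' := (Matrix.isUnit_iff_isUnit_det _).1 hDm
  have hEp' := (Matrix.isUnit_iff_isUnit_det _).1 hEp
  have hEm : B * Em = (Dm - Matrix.vecMulVec l b) * B := by
    have e : Em = Ep - c • 1 := by rw [hE]; abel
    have e' : Dm = Dp - c • 1 := by rw [hD]; abel
    rw [e, mul_sub, ← h, e']
    simp only [sub_mul, Matrix.smul_mul, Matrix.mul_smul, one_mul, mul_one]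
    abel
  have hP : Dp * Dm⁻¹ = 1 + c • Dm⁻¹ := by
    rw [hD, add_mul, Matrix.mul_nonsing_inv _ hDm', Matrix.smul_mul, one_mul]
  set k := 1 - (b ᵥ* Dp⁻¹) ⬝ᵥ l with hkdef
  have hvec : Matrix.vecMulVec (A *ᵥ (Dm⁻¹ *ᵥ l)) ((b ᵥ* Dp⁻¹) ᵥ* B) * Ep
      = k • (A * Dm⁻¹ * Matrix.vecMulVec l b * B) := by
    have h3 : (b ᵥ* Dp⁻¹) ᵥ* (Dp - Matrix.vecMulVec l b) = k • b := by
      rw [Matrix.vecMul_sub, Matrix.vecMul_vecMul, Matrix.nonsing_inv_mul _ hDp',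
        Matrix.vecMul_one, Matrix.vecMul_vecMulVec, hkdef, sub_smul, one_smul]
    rw [Matrix.vecMulVec_mul, Matrix.vecMul_vecMul, ← h, ← Matrix.vecMul_vecMul, h3,
      Matrix.mul_vecMulVec, Matrix.vecMulVec_mul, Matrix.smul_vecMul, Matrix.vecMulVec_smul,
      Matrix.mulVec_mulVec]
  have key : A * Dp * Dm⁻¹ * (B * Em * Ep⁻¹) * Ep = (A * B -
      (c * k⁻¹) • Matrix.vecMulVec (A *ᵥ (Dm⁻¹ *ᵥ l)) ((b ᵥ* Dp⁻¹) ᵥ* B)) * Ep := by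
    rw [sub_mul, Matrix.smul_mul, hvec, smul_smul, mul_assoc c, inv_mul_cancel₀ hk, mul_one,
      mul_assoc A B Ep, ← h, mul_assoc _ _ Ep, mul_assoc _ _ Ep,
      Matrix.nonsing_inv_mul _ hEp', mul_one, hEm]
    have e1 : A * Dp * Dm⁻¹ * ((Dm - Matrix.vecMulVec l b) * B)
        = A * Dp * (Dm⁻¹ * Dm) * B - A * (Dp * Dm⁻¹) * Matrix.vecMulVec l b * B := by
      noncomm_ring
    rw [e1, hP, Matrix.nonsing_inv_mul _ hDm']
    simp only [mul_add, add_mul, mul_one, Matrix.smul_mul, Matrix.mul_smul, mul_sub, sub_mul,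
      mul_assoc]
    abel
  exact hEp.mul_right_cancel key

/-- Sherman–Morrison together with the matrix determinant lemma. -/
theorem rank_one_green {N : ℕ} (M M' : Mat N) (u v : Fin N → ℂ) (c : ℂ)
    (hM : IsUnit M) (hM' : IsUnit M') (h : M' = M - c • Matrix.vecMulVec u v) :
    (M'.det / M.det) • (M'⁻¹ - M⁻¹) = c • (M⁻¹ * Matrix.vecMulVec u v * M⁻¹) := by
  have d := (Matrix.isUnit_iff_isUnit_det _).1 hM
  have d' := (Matrix.isUnit_iff_isUnit_det _).1 hM'
  have hf : M' = M * (1 - c • Matrix.vecMulVec (M⁻¹ *ᵥ u) v) := by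
    rw [h, mul_sub, mul_one, Matrix.mul_smul, Matrix.mul_vecMulVec, Matrix.mulVec_mulVec,
      Matrix.mul_nonsing_inv _ d, Matrix.one_mulVec]
  have hdet : M'.det / M.det = 1 - c * (v ⬝ᵥ (M⁻¹ *ᵥ u)) := by
    rw [hf, Matrix.det_mul, mul_div_cancel_left₀ _ d.ne_zero]
    have : (1 : Mat N) - c • Matrix.vecMulVec (M⁻¹ *ᵥ u) v
        = 1 + Matrix.replicateCol Unit ((-c) • (M⁻¹ *ᵥ u)) * Matrix.replicateRow Unit v := by
      rw [← Matrix.vecMulVec_eq, Matrix.smul_vecMulVec, neg_smul, sub_eq_add_neg]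
    rw [this, Matrix.det_one_add_replicateCol_mul_replicateRow, dotProduct_smul, smul_eq_mul]
    ring
  rw [hdet]
  have hM'u : M' * M⁻¹ * Matrix.vecMulVec u v
      = (1 - c * (v ⬝ᵥ (M⁻¹ *ᵥ u))) • Matrix.vecMulVec u v := by
    rw [h, sub_mul, Matrix.mul_nonsing_inv _ d, sub_mul, one_mul, Matrix.smul_mul,
      Matrix.smul_mul, mul_assoc, Matrix.mul_vecMulVec, Matrix.vecMulVec_mul_vecMulVec,
      sub_smul, one_smul, Matrix.vecMulVec_smul, smul_smul]
  apply hM'.mul_left_cancel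
  rw [Matrix.mul_smul, Matrix.mul_smul, mul_sub, Matrix.mul_nonsing_inv _ d', ← mul_assoc,
    ← mul_assoc, hM'u, Matrix.smul_mul, smul_comm c]
  congr 1
  rw [h, sub_mul, Matrix.mul_nonsing_inv _ d, Matrix.smul_mul]
  abel

/-- One half of the theorem, in symmetric form. -/
theorem half_green {N : ℕ} (l₁ l₂ ℓ₂ β₂ : Fin N → ℂ) (A₁ A₂ : Mat N)
    (h2 : (Dg l₁ - Matrix.vecMulVec ℓ₂ β₂) * A₂ = A₂ * Dg l₂)
    (hG : IsUnit (1 + A₁ * A₂))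
    (ζ : ℂ)
    (hζ1 : IsUnit (Dg l₁ - ζ • (1 : Mat N))) (hζ2 : IsUnit (Dg l₁ + ζ • (1 : Mat N)))
    (hζ4 : IsUnit (Dg l₂ + ζ • (1 : Mat N)))
    (hK2 : 1 - β₂z l₁ β₂ ζ ⬝ᵥ ℓ₂ ≠ 0)
    (hGζ : IsUnit (1 + shA₁ l₁ ζ A₁ * shA₂ l₂ ζ A₂)) :
    (tauD (shA₁ l₁ ζ A₁) (shA₂ l₂ ζ A₂) / tauD A₁ A₂) •
        (G₁D (shA₁ l₁ ζ A₁) (shA₂ l₂ ζ A₂) - G₁D A₁ A₂)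
      = (2 * ζ * K₂z l₁ β₂ ℓ₂ ζ) •
          (G₁D A₁ A₂ * A₁ * Matrix.vecMulVec (ℓ₂z l₁ ℓ₂ ζ) (β₂z l₁ β₂ ζ) *
            (G₂D A₁ A₂ * A₂)) := by
  have hs := rank_one_shift (Dg l₁ + ζ • 1) (Dg l₁ - ζ • 1) (Dg l₂ + ζ • 1) (Dg l₂ - ζ • 1)
    A₁ A₂ ℓ₂ β₂ (2 * ζ) hζ2 hζ1 hζ4 (by rw [two_mul, add_smul]; abel)
    (by rw [two_mul, add_smul]; abel)
    (by
      rw [mul_add, ← h2]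
      simp only [sub_mul, add_mul, Matrix.smul_mul, Matrix.mul_smul, one_mul, mul_one]
      abel) hK2
  have hr := rank_one_green (1 + A₁ * A₂) (1 + shA₁ l₁ ζ A₁ * shA₂ l₂ ζ A₂)
    (A₁ *ᵥ ℓ₂z l₁ ℓ₂ ζ) (β₂z l₁ β₂ ζ ᵥ* A₂) (2 * ζ * K₂z l₁ β₂ ℓ₂ ζ) hG hGζ
    (by
      unfold shA₁ shA₂
      rw [hs, add_sub_assoc]
      rfl)
  have hcomm : G₂D A₁ A₂ * A₂ = A₂ * (1 + A₁ * A₂)⁻¹ := by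
    have d := (Matrix.isUnit_iff_isUnit_det _).1 hG
    have d2 : IsUnit (1 + A₂ * A₁).det := by rwa [Matrix.det_one_add_mul_comm]
    have hu := (Matrix.isUnit_iff_isUnit_det _).2 d2
    apply hu.mul_left_cancel
    unfold G₂D
    rw [← mul_assoc, Matrix.mul_nonsing_inv _ d2, ← mul_assoc,
      show (1 + A₂ * A₁) * A₂ = A₂ * (1 + A₁ * A₂) by noncomm_ring,
      mul_assoc, Matrix.mul_nonsing_inv _ d, one_mul, mul_one]
  rw [hcomm]
  unfold tauD G₁D
  rw [hr, ← Matrix.mul_vecMulVec, ← Matrix.vecMulVec_mul]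
  simp only [mul_assoc, Matrix.mul_vecMulVec, Matrix.vecMulVec_mul, Matrix.vecMul_vecMul]

/-- one-shift formulae for the Green matrices:
`(τ^ζ/τ)·(G₁^ζ − G₁) = 2ζK₂ζ·G₁A₁·ℓ₂ζβ₂ζ·G₂A₂` and
`(τ^ζ/τ)·(G₂^ζ − G₂) = −2ζK₁ζ·G₂A₂·ℓ₁ζβ₁ζ·G₁A₁`. -/
theorem soliton_one_shift_green {N : ℕ} (hN : 1 ≤ N)
    (l₁ l₂ ℓ₁ ℓ₂ β₁ β₂ : Fin N → ℂ) (A₁ A₂ : Mat N)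
    (h1 : (Dg l₂ - Matrix.vecMulVec ℓ₁ β₁) * A₁ = A₁ * Dg l₁)
    (h2 : (Dg l₁ - Matrix.vecMulVec ℓ₂ β₂) * A₂ = A₂ * Dg l₂)
    (hG : IsUnit (1 + A₁ * A₂))
    (ζ : ℂ)
    (hζ1 : IsUnit (Dg l₁ - ζ • (1 : Mat N))) (hζ2 : IsUnit (Dg l₁ + ζ • (1 : Mat N)))
    (hζ3 : IsUnit (Dg l₂ - ζ • (1 : Mat N))) (hζ4 : IsUnit (Dg l₂ + ζ • (1 : Mat N)))
    (hK1 : 1 - β₁z l₂ β₁ ζ ⬝ᵥ ℓ₁ ≠ 0) (hK2 : 1 - β₂z l₁ β₂ ζ ⬝ᵥ ℓ₂ ≠ 0)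
    (hGζ : IsUnit (1 + shA₁ l₁ ζ A₁ * shA₂ l₂ ζ A₂)) :
    (tauD (shA₁ l₁ ζ A₁) (shA₂ l₂ ζ A₂) / tauD A₁ A₂) •
        (G₁D (shA₁ l₁ ζ A₁) (shA₂ l₂ ζ A₂) - G₁D A₁ A₂)
      = (2 * ζ * K₂z l₁ β₂ ℓ₂ ζ) •
          (G₁D A₁ A₂ * A₁ * Matrix.vecMulVec (ℓ₂z l₁ ℓ₂ ζ) (β₂z l₁ β₂ ζ) *
            (G₂D A₁ A₂ * A₂))
    ∧ (tauD (shA₁ l₁ ζ A₁) (shA₂ l₂ ζ A₂) / tauD A₁ A₂) •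
        (G₂D (shA₁ l₁ ζ A₁) (shA₂ l₂ ζ A₂) - G₂D A₁ A₂)
      = (-(2 * ζ * K₁z l₂ β₁ ℓ₁ ζ)) •
          (G₂D A₁ A₂ * A₂ * Matrix.vecMulVec (ℓ₁z l₂ ℓ₁ ζ) (β₁z l₂ β₁ ζ) *
            (G₁D A₁ A₂ * A₁)) := by
  refine ⟨half_green l₁ l₂ ℓ₂ β₂ A₁ A₂ h2 hG ζ hζ1 hζ2 hζ4 hK2 hGζ, ?_⟩
  have n1 : ∀ l : Fin N → ℂ, Dg l - (-ζ) • (1 : Mat N) = Dg l + ζ • 1 := by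
    intro l; rw [neg_smul, sub_neg_eq_add]
  have n2 : ∀ l : Fin N → ℂ, Dg l + (-ζ) • (1 : Mat N) = Dg l - ζ • 1 := by
    intro l; rw [neg_smul, sub_eq_add_neg]
  have flip : ∀ X Y : Mat N, IsUnit (1 + X * Y) → IsUnit (1 + Y * X) := by
    intro X Y h
    rw [Matrix.isUnit_iff_isUnit_det] at h ⊢
    rwa [Matrix.det_one_add_mul_comm]
  have s1 : shA₁ l₂ (-ζ) A₂ = shA₂ l₂ ζ A₂ := by unfold shA₁ shA₂; rw [n1, n2]
  have s2 : shA₂ l₁ (-ζ) A₁ = shA₁ l₁ ζ A₁ := by unfold shA₁ shA₂; rw [n1, n2]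
  have b : β₂z l₂ β₁ (-ζ) = β₁z l₂ β₁ ζ := by unfold β₁z β₂z; rw [n2]
  have e : ℓ₂z l₂ ℓ₁ (-ζ) = ℓ₁z l₂ ℓ₁ ζ := by unfold ℓ₁z ℓ₂z; rw [n1]
  have k : K₂z l₂ β₁ ℓ₁ (-ζ) = K₁z l₂ β₁ ℓ₁ ζ := by unfold K₁z K₂z; rw [b]
  have t : ∀ X Y : Mat N, tauD Y X = tauD X Y := fun X Y => Matrix.det_one_add_mul_comm _ _
  have h := half_green l₂ l₁ ℓ₁ β₁ A₂ A₁ h1 (flip _ _ hG) (-ζ) (by rwa [n1]) (by rwa [n2])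
    (by rwa [n2]) (by rwa [b]) (by rw [s1, s2]; exact flip _ _ hGζ)
  rw [s1, s2, b, e, k, t (shA₁ l₁ ζ A₁), t A₁,
    show 2 * -ζ * K₁z l₂ β₁ ℓ₁ ζ = -(2 * ζ * K₁z l₂ β₁ ℓ₁ ζ) by ring] at h
  exact h
end

section
/- In the soliton matrix setup, for any ζ ∈ ℂ such that L₁ − ζ, L₁ + ζ, L₂ − ζ, L₂ + ζ are invertible, 1 − β₁ζℓ₁ ≠ 0, 1 − β₂ζℓ₂ ≠ 0, and 1 + A₁^ζ A₂^ζ is invertible, the shifted scalars satisfy the four one-shift identities: (τ^ζ/τ)(p^ζ − p) = −2ζ·K_ζ·q_ζ·r_ζ, (τ^ζ/τ)(q^ζ − q) = 2ζ·K_ζ·q_ζ·s_ζ, (τ^ζ/τ)(r^ζ − r) = −2ζ·K_ζ·p_ζ·r_ζ, and (τ^ζ/τ)(s^ζ − s) = 2ζ·K_ζ·q_ζ·r_ζ, where X^ζ denotes the value of X computed from the shifted matrices A₁^ζ, A₂^ζ. -/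
open Matrix

section helpers
variable {n m : Type*} [Fintype n] [DecidableEq n] [Fintype m] [DecidableEq m]

lemma sol_core (L X T σ Z Z' : Matrix n n ℂ) (Λ : Matrix n m ℂ) (B : Matrix m n ℂ) (ζ : ℂ)
    (hσ : σ * X = -(X * σ)) (hL : (L - Λ * B) * X = X * L)
    (hZ : Z = L - ζ • σ) (hZ' : Z' = L + ζ • σ) (hT : Z' * T = Z) :
    (Z - Λ * B) * (1 + X * T) = (1 + X) * Z - Λ * B := by
  have h : (Z - Λ * B) * X = X * Z' := by
    have : (Z - Λ * B) * X = (L - Λ * B) * X - ζ • (σ * X) := by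
      rw [hZ, Matrix.sub_mul, Matrix.sub_mul, Matrix.sub_mul, Matrix.smul_mul]; abel
    rw [this, hL, hσ, hZ', Matrix.mul_add, Matrix.mul_smul, smul_neg, sub_neg_eq_add]
  rw [Matrix.mul_add, Matrix.mul_one, ← Matrix.mul_assoc, h, Matrix.mul_assoc, hT,
    Matrix.add_mul, Matrix.one_mul]
  abel

lemma sol_main (L X σ Z M W Mζ Wζ : Matrix n n ℂ) (Λ : Matrix n m ℂ) (B Bz : Matrix m n ℂ)
    (σ' : Matrix m m ℂ) (ζ : ℂ)
    (hL : (L - Λ * B) * X = X * L) (hM : M = 1 + X) (hMW : M * W = 1)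
    (hZ : Z = L - ζ • σ) (hBz : Bz * Z = B)
    (hcore : (Z - Λ * B) * Mζ = M * Z - Λ * B) (hMWζ : Mζ * Wζ = 1)
    (hs1 : Bz * σ = σ' * Bz) (hs2 : σ * Λ = Λ * σ') :
    (1 - Bz * W * Λ) * ((1 - B * Wζ * Λ) - (1 - B * W * Λ))
      = ζ • (σ' * (1 - Bz * W * Λ) - (1 - Bz * W * Λ) * σ') := by
  have hWM : W * M = 1 := mul_eq_one_comm.mp hMW
  have e1 : Z * Wζ - W * Λ * B * Wζ = W * Z - W * Λ * B := by
    have h : W * ((Z - Λ * B) * Mζ) * Wζ = W * (M * Z - Λ * B) * Wζ := by rw [hcore]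
    have h1 : W * ((Z - Λ * B) * Mζ) * Wζ = W * Z - W * Λ * B := by
      rw [Matrix.mul_assoc, Matrix.mul_assoc, hMWζ, Matrix.mul_one, Matrix.mul_sub,
        Matrix.mul_assoc]
    have h2 : W * (M * Z - Λ * B) * Wζ = Z * Wζ - W * Λ * B * Wζ := by
      rw [Matrix.mul_sub, ← Matrix.mul_assoc, hWM, Matrix.one_mul, Matrix.sub_mul,
        Matrix.mul_assoc W Λ B]
    rw [← h1, ← h2, h]
  have e2 : L * W - W * Λ * B * W = W * L - W * Λ * B := by
    have h : L * M - M * L = Λ * B * (M - 1) := by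
      have hX : M - 1 = X := by rw [hM]; abel
      rw [hX, hM, Matrix.mul_add, Matrix.add_mul, ← hL, Matrix.sub_mul]
      simp
    have h3 : W * (L * M - M * L) * W = W * (Λ * B * (M - 1)) * W := by rw [h]
    have h4 : W * (L * M - M * L) * W = W * L - L * W := by
      rw [Matrix.mul_sub, Matrix.sub_mul, ← Matrix.mul_assoc, ← Matrix.mul_assoc, hWM,
        Matrix.one_mul, Matrix.mul_assoc _ M W, hMW, Matrix.mul_one]
    have h5 : W * (Λ * B * (M - 1)) * W = W * Λ * B - W * Λ * B * W := by
      rw [Matrix.mul_assoc, Matrix.mul_assoc (Λ * B), Matrix.sub_mul, hMW, Matrix.mul_sub,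
        Matrix.mul_sub]
      simp only [Matrix.mul_assoc, Matrix.one_mul, Matrix.mul_one]
    rw [h4, h5] at h3
    have := congrArg (fun t => -t + W * L - W * Λ * B * W) h3
    calc _ = -(W * L - L * W) + W * L - W * Λ * B * W := by abel
      _ = _ := this
      _ = _ := by abel
  have e3 : Z * (W - Wζ) - W * Λ * B * (W - Wζ) = ζ • (W * σ - σ * W) := by
    have hL2 : L = Z + ζ • σ := by rw [hZ]; abel
    rw [hL2, Matrix.add_mul, Matrix.mul_add, Matrix.smul_mul, Matrix.mul_smul] at e2
    rw [Matrix.mul_sub, Matrix.mul_sub, smul_sub]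
    calc _ = (Z * W + ζ • (σ * W) - W * Λ * B * W) - ζ • (σ * W)
            - (Z * Wζ - W * Λ * B * Wζ) := by abel
      _ = _ := by rw [e2, e1]; abel
  have e4 : Bz * (Z * (W - Wζ) - W * Λ * B * (W - Wζ)) * Λ
      = (1 - Bz * W * Λ) * ((1 - B * Wζ * Λ) - (1 - B * W * Λ)) := by
    have : (1 - B * Wζ * Λ) - (1 - B * W * Λ) = B * (W - Wζ) * Λ := by
      rw [Matrix.mul_sub, Matrix.sub_mul]; abel
    rw [this, Matrix.sub_mul, Matrix.one_mul, Matrix.mul_sub, Matrix.sub_mul,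
      ← Matrix.mul_assoc, hBz]
    simp only [Matrix.mul_assoc]
  rw [← e4, e3, Matrix.mul_smul, Matrix.smul_mul]
  congr 1
  rw [Matrix.mul_sub, Matrix.sub_mul, Matrix.mul_sub, Matrix.sub_mul, Matrix.mul_one,
    Matrix.one_mul]
  have a1 : Bz * (W * σ) * Λ = Bz * W * Λ * σ' := by
    simp only [Matrix.mul_assoc, hs2]
  have a2 : Bz * (σ * W) * Λ = σ' * (Bz * W * Λ) := by
    rw [← Matrix.mul_assoc, hs1]; simp only [Matrix.mul_assoc]
  rw [a1, a2]; abel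

lemma sol_det (Z M W Mζ : Matrix n n ℂ) (Λ : Matrix n m ℂ) (B Bz : Matrix m n ℂ)
    (hMW : M * W = 1) (hBz : Bz * Z = B) (hZu : Z.det ≠ 0)
    (hcore : (Z - Λ * B) * Mζ = M * Z - Λ * B) :
    (1 - Bz * Λ).det * Mζ.det = M.det * (1 - Bz * W * Λ).det := by
  have h1 : Z - Λ * B = (1 - Λ * Bz) * Z := by
    rw [Matrix.sub_mul, Matrix.one_mul, Matrix.mul_assoc, hBz]
  have h2 : M * Z - Λ * B = M * (1 - W * Λ * Bz) * Z := by
    rw [Matrix.mul_sub, Matrix.sub_mul, Matrix.mul_one]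
    congr 1
    rw [← Matrix.mul_assoc, ← Matrix.mul_assoc, hMW, Matrix.one_mul, Matrix.mul_assoc, hBz]
  have h := congrArg Matrix.det hcore
  rw [h1, h2, Matrix.det_mul, Matrix.det_mul, Matrix.det_mul, Matrix.det_mul,
    Matrix.det_one_sub_mul_comm Λ Bz, Matrix.det_one_sub_mul_comm (W * Λ) Bz,
    ← Matrix.mul_assoc] at h
  apply mul_right_cancel₀ hZu
  linear_combination h

def solB {N : ℕ} (b₁ b₂ : Fin N → ℂ) : Matrix (Fin 1 ⊕ Fin 1) (Fin N ⊕ Fin N) ℂ :=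
  Matrix.fromBlocks (Matrix.replicateRow (Fin 1) b₁) 0 0 (Matrix.replicateRow (Fin 1) b₂)

def solC {N : ℕ} (b₁ b₂ : Fin N → ℂ) : Matrix (Fin N ⊕ Fin N) (Fin 1 ⊕ Fin 1) ℂ :=
  Matrix.fromBlocks (Matrix.replicateCol (Fin 1) b₁) 0 0 (Matrix.replicateCol (Fin 1) b₂)

def solM {N : ℕ} (A₁ A₂ : Mat N) : Matrix (Fin N ⊕ Fin N) (Fin N ⊕ Fin N) ℂ :=
  Matrix.fromBlocks 1 (-A₁) A₂ 1

noncomputable def solW {N : ℕ} (A₁ A₂ : Mat N) : Matrix (Fin N ⊕ Fin N) (Fin N ⊕ Fin N) ℂ :=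
  Matrix.fromBlocks (G₁D A₁ A₂) (G₁D A₁ A₂ * A₁) (-(G₂D A₁ A₂ * A₂)) (G₂D A₁ A₂)

def solS (a b c d : ℂ) : Matrix (Fin 1 ⊕ Fin 1) (Fin 1 ⊕ Fin 1) ℂ :=
  Matrix.fromBlocks !![a] !![b] !![c] !![d]

lemma solS_det (a b c d : ℂ) : (solS a b c d).det = a * d - b * c := by
  rw [← Matrix.det_submatrix_equiv_self (finSumFinEquiv (m := 1) (n := 1)).symm]
  rw [Matrix.det_fin_two]
  rfl

lemma solM_det {N : ℕ} (A₁ A₂ : Mat N) : (solM A₁ A₂).det = tauD A₁ A₂ := by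
  rw [solM, Matrix.det_fromBlocks_one₂₂, tauD]; simp

lemma solW_eq {N : ℕ} (A₁ A₂ : Mat N) (h : IsUnit (1 + A₁ * A₂)) :
    solM A₁ A₂ * solW A₁ A₂ = 1 := by
  have d1 : IsUnit (1 + A₁ * A₂).det := (Matrix.isUnit_iff_isUnit_det _).1 h
  have d2 : IsUnit (1 + A₂ * A₁).det := by rwa [Matrix.det_one_add_mul_comm]
  have g1 : (1 + A₁ * A₂) * G₁D A₁ A₂ = 1 := Matrix.mul_nonsing_inv _ d1
  have g1' : G₁D A₁ A₂ * (1 + A₁ * A₂) = 1 := Matrix.nonsing_inv_mul _ d1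
  have g2 : (1 + A₂ * A₁) * G₂D A₁ A₂ = 1 := Matrix.mul_nonsing_inv _ d2
  have g2' : G₂D A₁ A₂ * (1 + A₂ * A₁) = 1 := Matrix.nonsing_inv_mul _ d2
  have c1 : G₁D A₁ A₂ * A₁ = A₁ * G₂D A₁ A₂ := by
    calc _ = G₁D A₁ A₂ * A₁ * ((1 + A₂ * A₁) * G₂D A₁ A₂) := by rw [g2, Matrix.mul_one]
      _ = G₁D A₁ A₂ * (1 + A₁ * A₂) * (A₁ * G₂D A₁ A₂) := by noncomm_ring
      _ = _ := by rw [g1', Matrix.one_mul]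
  have c2 : G₂D A₁ A₂ * A₂ = A₂ * G₁D A₁ A₂ := by
    calc _ = G₂D A₁ A₂ * A₂ * ((1 + A₁ * A₂) * G₁D A₁ A₂) := by rw [g1, Matrix.mul_one]
      _ = G₂D A₁ A₂ * (1 + A₂ * A₁) * (A₂ * G₁D A₁ A₂) := by noncomm_ring
      _ = _ := by rw [g2', Matrix.one_mul]
  rw [solM, solW, Matrix.fromBlocks_multiply, ← Matrix.fromBlocks_one, c1, c2]
  congr 1
  · refine Eq.trans ?_ g1; noncomm_ring
  · noncomm_ring
  · noncomm_ring
  · refine Eq.trans ?_ g2; noncomm_ring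

lemma solS_eq {N : ℕ} (b₁ b₂ c₁ c₂ : Fin N → ℂ) (P Q R S : Mat N) :
    1 - solB b₁ b₂ * Matrix.fromBlocks P Q R S * solC c₁ c₂ =
      solS (1 - b₁ ⬝ᵥ (P *ᵥ c₁)) (-(b₁ ⬝ᵥ (Q *ᵥ c₂))) (-(b₂ ⬝ᵥ (R *ᵥ c₁)))
        (1 - b₂ ⬝ᵥ (S *ᵥ c₂)) := by
  rw [Matrix.mul_assoc, solB, solC, Matrix.fromBlocks_multiply, Matrix.fromBlocks_multiply,
    ← Matrix.fromBlocks_one, sub_eq_add_neg, Matrix.fromBlocks_neg, Matrix.fromBlocks_add, solS]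
  simp only [Matrix.zero_mul, Matrix.mul_zero, add_zero, zero_add]
  congr 1 <;> ext i j <;> fin_cases i <;> fin_cases j <;>
    simp [Matrix.mul_apply, dotProduct, Matrix.mulVec, sub_eq_add_neg]

lemma sol_S {N : ℕ} (b₁ b₂ c₁ c₂ : Fin N → ℂ) (A₁ A₂ : Mat N) :
    1 - solB b₁ b₂ * solW A₁ A₂ * solC c₁ c₂ =
      solS (1 - b₁ ⬝ᵥ (G₁D A₁ A₂ *ᵥ c₁)) (-(b₁ ⬝ᵥ (G₁D A₁ A₂ *ᵥ (A₁ *ᵥ c₂))))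
        (b₂ ⬝ᵥ (G₂D A₁ A₂ *ᵥ (A₂ *ᵥ c₁))) (1 - b₂ ⬝ᵥ (G₂D A₁ A₂ *ᵥ c₂)) := by
  rw [solW, solS_eq]
  simp [Matrix.neg_mulVec, Matrix.mulVec_mulVec]

lemma sol_shift_aux {N : ℕ} (l : Fin N → ℂ) (ζ : ℂ)
    (h : IsUnit (Dg l + ζ • (1 : Mat N))) :
    (Dg l + ζ • 1) * ((Dg l - ζ • 1) * (Dg l + ζ • 1)⁻¹) = Dg l - ζ • (1 : Mat N) := by
  have d : IsUnit (Dg l + ζ • (1 : Mat N)).det := (Matrix.isUnit_iff_isUnit_det _).1 h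
  have c : (Dg l + ζ • 1) * (Dg l - ζ • (1 : Mat N)) = (Dg l - ζ • 1) * (Dg l + ζ • 1) := by
    simp only [Matrix.mul_sub, Matrix.add_mul, Matrix.mul_add, Matrix.sub_mul, Matrix.smul_mul,
      Matrix.mul_smul, Matrix.mul_one, Matrix.one_mul, smul_add, smul_sub]
    abel
  rw [← Matrix.mul_assoc, c, Matrix.mul_assoc, Matrix.mul_nonsing_inv _ d, Matrix.mul_one]

end helpers

/-- one-shift identities for the scalars `p, q, r, s`:
`(τ^ζ/τ)(p^ζ − p) = −2ζK_ζ q_ζ r_ζ`, `(τ^ζ/τ)(q^ζ − q) = 2ζK_ζ q_ζ s_ζ`,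
`(τ^ζ/τ)(r^ζ − r) = −2ζK_ζ p_ζ r_ζ`, `(τ^ζ/τ)(s^ζ − s) = 2ζK_ζ q_ζ r_ζ`. -/
theorem soliton_one_shift_scalars {N : ℕ} (hN : 1 ≤ N)
    (l₁ l₂ ℓ₁ ℓ₂ β₁ β₂ : Fin N → ℂ) (A₁ A₂ : Mat N)
    (h1 : (Dg l₂ - Matrix.vecMulVec ℓ₁ β₁) * A₁ = A₁ * Dg l₁)
    (h2 : (Dg l₁ - Matrix.vecMulVec ℓ₂ β₂) * A₂ = A₂ * Dg l₂)
    (hG : IsUnit (1 + A₁ * A₂))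
    (ζ : ℂ)
    (hζ1 : IsUnit (Dg l₁ - ζ • (1 : Mat N))) (hζ2 : IsUnit (Dg l₁ + ζ • (1 : Mat N)))
    (hζ3 : IsUnit (Dg l₂ - ζ • (1 : Mat N))) (hζ4 : IsUnit (Dg l₂ + ζ • (1 : Mat N)))
    (hK1 : 1 - β₁z l₂ β₁ ζ ⬝ᵥ ℓ₁ ≠ 0) (hK2 : 1 - β₂z l₁ β₂ ζ ⬝ᵥ ℓ₂ ≠ 0)
    (hGζ : IsUnit (1 + shA₁ l₁ ζ A₁ * shA₂ l₂ ζ A₂)) :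
    (tauD (shA₁ l₁ ζ A₁) (shA₂ l₂ ζ A₂) / tauD A₁ A₂) *
        (pD β₁ ℓ₁ (shA₁ l₁ ζ A₁) (shA₂ l₂ ζ A₂) - pD β₁ ℓ₁ A₁ A₂)
      = -(2 * ζ) * Kz l₁ l₂ β₁ β₂ ℓ₁ ℓ₂ ζ * qz l₂ β₁ ℓ₂ ζ A₁ A₂ * rz l₁ β₂ ℓ₁ ζ A₁ A₂
    ∧ (tauD (shA₁ l₁ ζ A₁) (shA₂ l₂ ζ A₂) / tauD A₁ A₂) *
        (qD β₁ ℓ₂ (shA₁ l₁ ζ A₁) (shA₂ l₂ ζ A₂) - qD β₁ ℓ₂ A₁ A₂)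
      = 2 * ζ * Kz l₁ l₂ β₁ β₂ ℓ₁ ℓ₂ ζ * qz l₂ β₁ ℓ₂ ζ A₁ A₂ * sz l₁ β₂ ℓ₂ ζ A₁ A₂
    ∧ (tauD (shA₁ l₁ ζ A₁) (shA₂ l₂ ζ A₂) / tauD A₁ A₂) *
        (rD β₂ ℓ₁ (shA₁ l₁ ζ A₁) (shA₂ l₂ ζ A₂) - rD β₂ ℓ₁ A₁ A₂)
      = -(2 * ζ) * Kz l₁ l₂ β₁ β₂ ℓ₁ ℓ₂ ζ * pz l₂ β₁ ℓ₁ ζ A₁ A₂ * rz l₁ β₂ ℓ₁ ζ A₁ A₂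
    ∧ (tauD (shA₁ l₁ ζ A₁) (shA₂ l₂ ζ A₂) / tauD A₁ A₂) *
        (sD β₂ ℓ₂ (shA₁ l₁ ζ A₁) (shA₂ l₂ ζ A₂) - sD β₂ ℓ₂ A₁ A₂)
      = 2 * ζ * Kz l₁ l₂ β₁ β₂ ℓ₁ ℓ₂ ζ * qz l₂ β₁ ℓ₂ ζ A₁ A₂ * rz l₁ β₂ ℓ₁ ζ A₁ A₂ := by
  have hZ₁ : IsUnit (Dg l₁ + ζ • (1 : Mat N)).det := (Matrix.isUnit_iff_isUnit_det _).1 hζ2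
  have hZ₂ : IsUnit (Dg l₂ - ζ • (1 : Mat N)).det := (Matrix.isUnit_iff_isUnit_det _).1 hζ3
  set B₁ := shA₁ l₁ ζ A₁ with hB₁
  set B₂ := shA₂ l₂ ζ A₂ with hB₂
  let L : Matrix (Fin N ⊕ Fin N) (Fin N ⊕ Fin N) ℂ := Matrix.fromBlocks (Dg l₂) 0 0 (Dg l₁)
  let σ : Matrix (Fin N ⊕ Fin N) (Fin N ⊕ Fin N) ℂ := Matrix.fromBlocks 1 0 0 (-1)
  let X : Matrix (Fin N ⊕ Fin N) (Fin N ⊕ Fin N) ℂ := Matrix.fromBlocks 0 (-A₁) A₂ 0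
  let Z : Matrix (Fin N ⊕ Fin N) (Fin N ⊕ Fin N) ℂ :=
    Matrix.fromBlocks (Dg l₂ - ζ • 1) 0 0 (Dg l₁ + ζ • 1)
  let Z' : Matrix (Fin N ⊕ Fin N) (Fin N ⊕ Fin N) ℂ :=
    Matrix.fromBlocks (Dg l₂ + ζ • 1) 0 0 (Dg l₁ - ζ • 1)
  let T : Matrix (Fin N ⊕ Fin N) (Fin N ⊕ Fin N) ℂ :=
    Matrix.fromBlocks ((Dg l₂ - ζ • 1) * (Dg l₂ + ζ • 1)⁻¹) 0 0
      ((Dg l₁ + ζ • 1) * (Dg l₁ - ζ • 1)⁻¹)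
  have hσ : σ * X = -(X * σ) := by
    simp [σ, X, Matrix.fromBlocks_multiply, Matrix.fromBlocks_neg]
  have hΛB : solC ℓ₁ ℓ₂ * solB β₁ β₂ =
      Matrix.fromBlocks (Matrix.vecMulVec ℓ₁ β₁) 0 0 (Matrix.vecMulVec ℓ₂ β₂) := by
    rw [solC, solB, Matrix.fromBlocks_multiply]
    congr 1 <;> ext i j <;> simp [Matrix.mul_apply, Matrix.vecMulVec_apply]
  have hL : (L - solC ℓ₁ ℓ₂ * solB β₁ β₂) * X = X * L := by
    rw [hΛB, sub_eq_add_neg, Matrix.fromBlocks_neg, Matrix.fromBlocks_add,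
      Matrix.fromBlocks_multiply, Matrix.fromBlocks_multiply]
    simp only [neg_zero, add_zero, zero_add, Matrix.zero_mul, Matrix.mul_zero, Matrix.mul_neg,
      Matrix.neg_mul, ← sub_eq_add_neg, h1, h2, zero_sub]
  have hZ : Z = L - ζ • σ := by
    rw [sub_eq_add_neg, Matrix.fromBlocks_smul, Matrix.fromBlocks_neg, Matrix.fromBlocks_add]
    simp [Z, sub_eq_add_neg]
  have hZ' : Z' = L + ζ • σ := by
    rw [Matrix.fromBlocks_smul, Matrix.fromBlocks_add]
    simp [Z', sub_eq_add_neg]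
  have hT : Z' * T = Z := by
    rw [Matrix.fromBlocks_multiply]
    have t1 := sol_shift_aux l₂ ζ hζ4
    have t2 := sol_shift_aux l₁ (-ζ) (by simpa [← sub_eq_add_neg] using hζ1)
    simp only [neg_smul, sub_neg_eq_add, ← sub_eq_add_neg] at t2
    simp only [add_zero, zero_add, Matrix.zero_mul, Matrix.mul_zero, t1, t2]
    rfl
  have hM : solM A₁ A₂ = 1 + X := by
    rw [← Matrix.fromBlocks_one, Matrix.fromBlocks_add, solM]; simp
  have hMζ : solM B₁ B₂ = 1 + X * T := by
    rw [← Matrix.fromBlocks_one, Matrix.fromBlocks_multiply, Matrix.fromBlocks_add, solM,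
      hB₁, hB₂, shA₁, shA₂]
    simp [Matrix.mul_assoc]
  have hMW := solW_eq A₁ A₂ hG
  have hMWζ := solW_eq B₁ B₂ hGζ
  have hBz : solB (β₁z l₂ β₁ ζ) (β₂z l₁ β₂ ζ) * Z = solB β₁ β₂ := by
    have r1 : β₁z l₂ β₁ ζ ᵥ* (Dg l₂ - ζ • 1) = β₁ := by
      rw [β₁z, Matrix.vecMul_vecMul, Matrix.nonsing_inv_mul _ hZ₂, Matrix.vecMul_one]
    have r2 : β₂z l₁ β₂ ζ ᵥ* (Dg l₁ + ζ • 1) = β₂ := by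
      rw [β₂z, Matrix.vecMul_vecMul, Matrix.nonsing_inv_mul _ hZ₁, Matrix.vecMul_one]
    rw [solB, Matrix.fromBlocks_multiply, solB]
    simp only [add_zero, zero_add, Matrix.zero_mul, Matrix.mul_zero, ← Matrix.replicateRow_vecMul,
      r1, r2]
  have hcore : (Z - solC ℓ₁ ℓ₂ * solB β₁ β₂) * solM B₁ B₂
      = solM A₁ A₂ * Z - solC ℓ₁ ℓ₂ * solB β₁ β₂ := by
    rw [hM, hMζ]
    exact sol_core L X T σ Z Z' _ _ ζ hσ hL hZ hZ' hT
  have hZu : Z.det ≠ 0 := by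
    rw [Matrix.det_fromBlocks_zero₂₁]
    exact mul_ne_zero hZ₂.ne_zero hZ₁.ne_zero
  have hs1 : solB (β₁z l₂ β₁ ζ) (β₂z l₁ β₂ ζ) * σ
      = solS 1 0 0 (-1) * solB (β₁z l₂ β₁ ζ) (β₂z l₁ β₂ ζ) := by
    rw [solB, solS, Matrix.fromBlocks_multiply, Matrix.fromBlocks_multiply]
    congr 1 <;> ext i j <;> fin_cases i <;> simp [Matrix.mul_apply, Matrix.vecMul, dotProduct]
  have hs2 : σ * solC ℓ₁ ℓ₂ = solC ℓ₁ ℓ₂ * solS 1 0 0 (-1) := by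
    rw [solC, solS, Matrix.fromBlocks_multiply, Matrix.fromBlocks_multiply]
    congr 1 <;> ext i j <;> fin_cases j <;> simp [Matrix.mul_apply]
  have main := sol_main L X σ Z _ _ _ _ (solC ℓ₁ ℓ₂) _ _ _ ζ hL hM hMW hZ hBz hcore hMWζ hs1 hs2
  have hdet := sol_det Z _ _ _ (solC ℓ₁ ℓ₂) _ _ hMW hBz hZu hcore
  have hK : 1 - solB (β₁z l₂ β₁ ζ) (β₂z l₁ β₂ ζ) * solC ℓ₁ ℓ₂
      = solS (1 - β₁z l₂ β₁ ζ ⬝ᵥ ℓ₁) 0 0 (1 - β₂z l₁ β₂ ζ ⬝ᵥ ℓ₂) := by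
    have := solS_eq (β₁z l₂ β₁ ζ) (β₂z l₁ β₂ ζ) ℓ₁ ℓ₂ 1 0 0 1
    rw [Matrix.fromBlocks_one, Matrix.mul_one] at this
    simpa using this
  rw [hK, sol_S, solS_det, solS_det, solM_det, solM_det] at hdet
  rw [sol_S, sol_S, sol_S] at main
  change solS (pz l₂ β₁ ℓ₁ ζ A₁ A₂) (-(qz l₂ β₁ ℓ₂ ζ A₁ A₂)) (rz l₁ β₂ ℓ₁ ζ A₁ A₂)
      (sz l₁ β₂ ℓ₂ ζ A₁ A₂) *
      (solS (pD β₁ ℓ₁ B₁ B₂) (-(qD β₁ ℓ₂ B₁ B₂)) (rD β₂ ℓ₁ B₁ B₂) (sD β₂ ℓ₂ B₁ B₂) -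
       solS (pD β₁ ℓ₁ A₁ A₂) (-(qD β₁ ℓ₂ A₁ A₂)) (rD β₂ ℓ₁ A₁ A₂) (sD β₂ ℓ₂ A₁ A₂)) =
      ζ • (solS 1 0 0 (-1) * solS (pz l₂ β₁ ℓ₁ ζ A₁ A₂) (-(qz l₂ β₁ ℓ₂ ζ A₁ A₂))
        (rz l₁ β₂ ℓ₁ ζ A₁ A₂) (sz l₁ β₂ ℓ₂ ζ A₁ A₂) -
        solS (pz l₂ β₁ ℓ₁ ζ A₁ A₂) (-(qz l₂ β₁ ℓ₂ ζ A₁ A₂))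
        (rz l₁ β₂ ℓ₁ ζ A₁ A₂) (sz l₁ β₂ ℓ₂ ζ A₁ A₂) * solS 1 0 0 (-1)) at main
  change _ = tauD A₁ A₂ * (pz l₂ β₁ ℓ₁ ζ A₁ A₂ * sz l₁ β₂ ℓ₂ ζ A₁ A₂
    - -(qz l₂ β₁ ℓ₂ ζ A₁ A₂) * rz l₁ β₂ ℓ₁ ζ A₁ A₂) at hdet
  have hτ : tauD A₁ A₂ ≠ 0 := ((Matrix.isUnit_iff_isUnit_det _).1 hG).ne_zero
  have hratio : tauD B₁ B₂ / tauD A₁ A₂ = Kz l₁ l₂ β₁ β₂ ℓ₁ ℓ₂ ζ *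
      (pz l₂ β₁ ℓ₁ ζ A₁ A₂ * sz l₁ β₂ ℓ₂ ζ A₁ A₂
        + qz l₂ β₁ ℓ₂ ζ A₁ A₂ * rz l₁ β₂ ℓ₁ ζ A₁ A₂) := by
    rw [Kz, K₁z, K₂z, ← mul_inv, inv_mul_eq_div, div_eq_div_iff hτ (mul_ne_zero hK1 hK2)]
    linear_combination hdet
  rw [hratio]
  have m11 := congrFun (congrFun main (Sum.inl 0)) (Sum.inl 0)
  have m12 := congrFun (congrFun main (Sum.inl 0)) (Sum.inr 0)
  have m21 := congrFun (congrFun main (Sum.inr 0)) (Sum.inl 0)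
  have m22 := congrFun (congrFun main (Sum.inr 0)) (Sum.inr 0)
  clear main hdet hratio
  simp [solS, Matrix.mul_apply] at m11 m12 m21 m22
  generalize pz l₂ β₁ ℓ₁ ζ A₁ A₂ = p at *
  generalize qz l₂ β₁ ℓ₂ ζ A₁ A₂ = q at *
  generalize rz l₁ β₂ ℓ₁ ζ A₁ A₂ = r at *
  generalize sz l₁ β₂ ℓ₂ ζ A₁ A₂ = s at *
  generalize Kz l₁ l₂ β₁ β₂ ℓ₁ ℓ₂ ζ = K at *
  refine ⟨?_, ?_, ?_, ?_⟩
  · linear_combination K * s * m11 + K * q * m21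
  · linear_combination -K * s * m12 - K * q * m22
  · linear_combination K * p * m21 - K * r * m11
  · linear_combination K * p * m22 - K * r * m12
end

section
/- In the soliton matrix setup, for any ζ ∈ ℂ such that L₁ − ζ, L₁ + ζ, L₂ − ζ, L₂ + ζ are invertible and 1 − β₁ζℓ₁ ≠ 0 and 1 − β₂ζℓ₂ ≠ 0, the ratio of the shifted and unshifted tau-functions factorizes as τ^ζ/τ = K_ζ·(p_ζ·s_ζ + q_ζ·r_ζ), where τ^ζ = det(1 + A₁^ζ A₂^ζ). -/
open Matrix

/-- determinant of a two-by-two block matrix with scalar blocks. -/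
theorem aux_det_two (a b c d : Matrix (Fin 1) (Fin 1) ℂ) :
    (fromBlocks a b c d).det = a 0 0 * d 0 0 - b 0 0 * c 0 0 := by
  rw [← Matrix.det_submatrix_equiv_self (finSumFinEquiv (m := 1) (n := 1)).symm,
    Matrix.det_fin_two]
  have e0 : (finSumFinEquiv (m := 1) (n := 1)).symm 0 = Sum.inl 0 := by decide
  have e1 : (finSumFinEquiv (m := 1) (n := 1)).symm 1 = Sum.inr 0 := by decide
  simp [e0, e1]

/-- rank-two perturbation of the block matrix `[[1, -A₁], [A₂, 1]]`. -/
theorem aux_perturb {N : ℕ} (A₁ A₂ G₁ G₂ : Matrix (Fin N) (Fin N) ℂ)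
    (c₁ c₂ : Matrix (Fin N) (Fin 1) ℂ) (r₁ r₂ : Matrix (Fin 1) (Fin N) ℂ)
    (hG₁ : (1 + A₁ * A₂) * G₁ = 1) (hG₂ : (1 + A₂ * A₁) * G₂ = 1)
    (hA₁ : G₁ * A₁ = A₁ * G₂) (hA₂ : G₂ * A₂ = A₂ * G₁) :
    (fromBlocks (1 - c₁ * r₁) (-A₁) A₂ (1 - c₂ * r₂)).det
      = (1 + A₁ * A₂).det *
        (fromBlocks (1 - r₁ * (G₁ * c₁)) (-(r₁ * (G₁ * (A₁ * c₂))))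
          (r₂ * (G₂ * (A₂ * c₁))) (1 - r₂ * (G₂ * c₂))).det := by
  set B : Matrix (Fin N ⊕ Fin N) (Fin N ⊕ Fin N) ℂ := fromBlocks 1 (-A₁) A₂ 1 with hB
  set C : Matrix (Fin N ⊕ Fin N) (Fin N ⊕ Fin N) ℂ :=
    fromBlocks G₁ (G₁ * A₁) (-(G₂ * A₂)) G₂ with hC
  set U : Matrix (Fin N ⊕ Fin N) (Fin 1 ⊕ Fin 1) ℂ := fromBlocks c₁ 0 0 c₂ with hU
  set V : Matrix (Fin 1 ⊕ Fin 1) (Fin N ⊕ Fin N) ℂ := fromBlocks r₁ 0 0 r₂ with hV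
  have hBC : B * C = 1 := by
    rw [hB, hC, fromBlocks_multiply, ← fromBlocks_one, hA₁, hA₂]
    congr 1
    · refine Eq.trans ?_ hG₁; noncomm_ring
    · simp
    · simp
    · refine Eq.trans ?_ hG₂; noncomm_ring
  have hdB : B.det = (1 + A₁ * A₂).det := by
    rw [hB, det_fromBlocks_one₂₂]; simp
  have e1 : fromBlocks (1 - c₁ * r₁) (-A₁) A₂ (1 - c₂ * r₂) = B * (1 - (C * U) * V) := by
    rw [Matrix.mul_sub, ← Matrix.mul_assoc, ← Matrix.mul_assoc, hBC]
    simp [hB, hU, hV, fromBlocks_multiply, sub_eq_add_neg, fromBlocks_neg, fromBlocks_add]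
  have e2 : fromBlocks (1 - r₁ * (G₁ * c₁)) (-(r₁ * (G₁ * (A₁ * c₂))))
          (r₂ * (G₂ * (A₂ * c₁))) (1 - r₂ * (G₂ * c₂)) = 1 - V * (C * U) := by
    have e : 1 - V * (C * U) = fromBlocks 1 0 0 1 + -(V * (C * U)) := by
      rw [fromBlocks_one, sub_eq_add_neg]
    rw [e, hC, hU, hV, fromBlocks_multiply, fromBlocks_multiply, fromBlocks_neg, fromBlocks_add]
    simp [sub_eq_add_neg, Matrix.mul_assoc]
  rw [e1, e2, det_mul, hdB, det_one_sub_mul_comm]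

/-- determinant of a shifted tau-function in block form (`X = M₂ - c₁ b₁`). -/
theorem aux_shift {N : ℕ} (A₁ A₂ M₁ P₁ M₂ P₂ X Y T W : Matrix (Fin N) (Fin N) ℂ)
    (hM₁ : IsUnit M₁.det) (hP₁ : IsUnit P₁.det) (hM₂ : IsUnit M₂.det) (hP₂ : IsUnit P₂.det)
    (hc1 : M₁ * P₁ = P₁ * M₁) (hc2 : M₂ * P₂ = P₂ * M₂)
    (hX : X * A₁ = A₁ * M₁) (hY : Y * A₂ = A₂ * P₂)
    (hT : X = T * M₂) (hW : Y = W * P₁) (hTd : IsUnit T.det) (hWd : IsUnit W.det) :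
    T.det * W.det * (1 + A₁ * P₁ * M₁⁻¹ * (A₂ * M₂ * P₂⁻¹)).det
      = (fromBlocks T (-A₁) A₂ W).det := by
  have hXd : IsUnit X.det := by rw [hT, det_mul]; exact hTd.mul hM₂
  have hYd : IsUnit Y.det := by rw [hW, det_mul]; exact hWd.mul hP₁
  have a1 : A₁ * P₁ * M₁⁻¹ = M₂⁻¹ * (T⁻¹ * A₁ * P₁) := by
    have h : X * (A₁ * P₁ * M₁⁻¹) = A₁ * P₁ := by
      rw [← Matrix.mul_assoc, ← Matrix.mul_assoc, hX, Matrix.mul_assoc A₁, hc1,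
        ← Matrix.mul_assoc, mul_nonsing_inv_cancel_right _ _ hM₁]
    have h' := congrArg (fun Z => X⁻¹ * Z) h
    simp only [nonsing_inv_mul_cancel_left _ _ hXd] at h'
    rw [h', hT, Matrix.mul_inv_rev]; simp only [Matrix.mul_assoc]
  have a2 : A₂ * M₂ * P₂⁻¹ = P₁⁻¹ * (W⁻¹ * A₂ * M₂) := by
    have h : Y * (A₂ * M₂ * P₂⁻¹) = A₂ * M₂ := by
      rw [← Matrix.mul_assoc, ← Matrix.mul_assoc, hY, Matrix.mul_assoc A₂, ← hc2,
        ← Matrix.mul_assoc, mul_nonsing_inv_cancel_right _ _ hP₂]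
    have h' := congrArg (fun Z => Y⁻¹ * Z) h
    simp only [nonsing_inv_mul_cancel_left _ _ hYd] at h'
    rw [h', hW, Matrix.mul_inv_rev]; simp only [Matrix.mul_assoc]
  have a3 : A₁ * P₁ * M₁⁻¹ * (A₂ * M₂ * P₂⁻¹) = M₂⁻¹ * (T⁻¹ * A₁ * (W⁻¹ * A₂) * M₂) := by
    rw [a1, a2]
    have : P₁ * (P₁⁻¹ * (W⁻¹ * A₂ * M₂)) = W⁻¹ * A₂ * M₂ := mul_nonsing_inv_cancel_left _ _ hP₁
    simp only [Matrix.mul_assoc] at this ⊢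
    rw [this]
  have a4 : fromBlocks T (-A₁) A₂ W
      = fromBlocks T 0 0 W * fromBlocks 1 (-(T⁻¹ * A₁)) (W⁻¹ * A₂) 1 := by
    rw [fromBlocks_multiply]
    simp [mul_nonsing_inv_cancel_left _ _ hTd, mul_nonsing_inv_cancel_left _ _ hWd]
  rw [a3, det_one_add_mul_comm, Matrix.mul_assoc _ M₂, mul_nonsing_inv _ hM₂, Matrix.mul_one, a4,
    det_mul, det_fromBlocks_zero₂₁, det_fromBlocks_one₂₂]
  simp

/-- factorization of the tau-ratio: `τ^ζ/τ = K_ζ(p_ζ s_ζ + q_ζ r_ζ)`. -/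
theorem soliton_tau_ratio_factorization {N : ℕ} (hN : 1 ≤ N)
    (l₁ l₂ ℓ₁ ℓ₂ β₁ β₂ : Fin N → ℂ) (A₁ A₂ : Mat N)
    (h1 : (Dg l₂ - Matrix.vecMulVec ℓ₁ β₁) * A₁ = A₁ * Dg l₁)
    (h2 : (Dg l₁ - Matrix.vecMulVec ℓ₂ β₂) * A₂ = A₂ * Dg l₂)
    (hG : IsUnit (1 + A₁ * A₂))
    (ζ : ℂ)
    (hζ1 : IsUnit (Dg l₁ - ζ • (1 : Mat N))) (hζ2 : IsUnit (Dg l₁ + ζ • (1 : Mat N)))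
    (hζ3 : IsUnit (Dg l₂ - ζ • (1 : Mat N))) (hζ4 : IsUnit (Dg l₂ + ζ • (1 : Mat N)))
    (hK1 : 1 - β₁z l₂ β₁ ζ ⬝ᵥ ℓ₁ ≠ 0) (hK2 : 1 - β₂z l₁ β₂ ζ ⬝ᵥ ℓ₂ ≠ 0) :
    tauD (shA₁ l₁ ζ A₁) (shA₂ l₂ ζ A₂) / tauD A₁ A₂
      = Kz l₁ l₂ β₁ β₂ ℓ₁ ℓ₂ ζ *
          (pz l₂ β₁ ℓ₁ ζ A₁ A₂ * sz l₁ β₂ ℓ₂ ζ A₁ A₂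
            + qz l₂ β₁ ℓ₂ ζ A₁ A₂ * rz l₁ β₂ ℓ₁ ζ A₁ A₂) := by
  have hGd : IsUnit (1 + A₁ * A₂).det := (isUnit_iff_isUnit_det _).1 hG
  have hGd' : IsUnit (1 + A₂ * A₁).det := by rwa [det_one_add_mul_comm]
  have hζ1 := (isUnit_iff_isUnit_det _).1 hζ1
  have hζ2 := (isUnit_iff_isUnit_det _).1 hζ2
  have hζ3 := (isUnit_iff_isUnit_det _).1 hζ3
  have hζ4 := (isUnit_iff_isUnit_det _).1 hζ4
  have hcomm : ∀ l : Fin N → ℂ, (Dg l - ζ • (1 : Mat N)) * (Dg l + ζ • (1 : Mat N))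
      = (Dg l + ζ • (1 : Mat N)) * (Dg l - ζ • (1 : Mat N)) := by
    intro l
    have hc : Commute (Dg l) (ζ • (1 : Mat N)) := (Commute.one_right _).smul_right ζ
    have h1 : Commute (Dg l - ζ • (1 : Mat N)) (ζ • (1 : Mat N)) :=
      (Commute.one_right _).smul_right ζ
    have h2 : Commute (Dg l - ζ • (1 : Mat N)) (Dg l) := (Commute.refl _).sub_left hc.symm
    exact (h2.add_right h1).eq
  have hG1 : (1 + A₁ * A₂) * G₁D A₁ A₂ = 1 := mul_nonsing_inv _ hGd
  have hG2 : (1 + A₂ * A₁) * G₂D A₁ A₂ = 1 := mul_nonsing_inv _ hGd'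
  have hG1' : G₁D A₁ A₂ * (1 + A₁ * A₂) = 1 := nonsing_inv_mul _ hGd
  have hG2' : G₂D A₁ A₂ * (1 + A₂ * A₁) = 1 := nonsing_inv_mul _ hGd'
  have hA1 : G₁D A₁ A₂ * A₁ = A₁ * G₂D A₁ A₂ := by
    calc G₁D A₁ A₂ * A₁ = G₁D A₁ A₂ * (A₁ * ((1 + A₂ * A₁) * G₂D A₁ A₂)) := by
          rw [hG2, Matrix.mul_one]
      _ = (G₁D A₁ A₂ * (1 + A₁ * A₂)) * (A₁ * G₂D A₁ A₂) := by noncomm_ring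
      _ = _ := by rw [hG1', Matrix.one_mul]
  have hA2 : G₂D A₁ A₂ * A₂ = A₂ * G₁D A₁ A₂ := by
    calc G₂D A₁ A₂ * A₂ = G₂D A₁ A₂ * (A₂ * ((1 + A₁ * A₂) * G₁D A₁ A₂)) := by
          rw [hG1, Matrix.mul_one]
      _ = (G₂D A₁ A₂ * (1 + A₂ * A₁)) * (A₂ * G₁D A₁ A₂) := by noncomm_ring
      _ = _ := by rw [hG2', Matrix.one_mul]
  have hdet : ∀ c r : Fin N → ℂ,
      (1 - replicateCol (Fin 1) c * replicateRow (Fin 1) r).det = 1 - r ⬝ᵥ c := by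
    intro c r
    rw [det_one_sub_mul_comm]
    simp [Matrix.mul_apply, dotProduct]
  have hfac : ∀ (c r : Fin N → ℂ) (M : Mat N), IsUnit M.det → M - vecMulVec c r
      = (1 - replicateCol (Fin 1) c * replicateRow (Fin 1) (r ᵥ* M⁻¹)) * M := by
    intro c r M hM
    rw [Matrix.sub_mul, Matrix.one_mul, replicateRow_vecMul, Matrix.mul_assoc, Matrix.mul_assoc,
      nonsing_inv_mul _ hM, Matrix.mul_one, vecMulVec_eq (Fin 1)]
    rfl
  have key := aux_shift A₁ A₂ _ _ _ _
    (Dg l₂ - ζ • (1 : Mat N) - vecMulVec ℓ₁ β₁) (Dg l₁ + ζ • (1 : Mat N) - vecMulVec ℓ₂ β₂)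
    _ _ hζ1 hζ2 hζ3 hζ4 (hcomm l₁) (hcomm l₂)
    (by
      have : Dg l₂ - ζ • (1 : Mat N) - vecMulVec ℓ₁ β₁
        = Dg l₂ - vecMulVec ℓ₁ β₁ - ζ • (1 : Mat N) := by abel
      rw [this, Matrix.sub_mul, h1, Matrix.mul_sub]; simp)
    (by
      have : Dg l₁ + ζ • (1 : Mat N) - vecMulVec ℓ₂ β₂
        = Dg l₁ - vecMulVec ℓ₂ β₂ + ζ • (1 : Mat N) := by abel
      rw [this, Matrix.add_mul, h2, Matrix.mul_add]; simp)
    (hfac ℓ₁ β₁ _ hζ3) (hfac ℓ₂ β₂ _ hζ2)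
    (by rw [hdet]; exact isUnit_iff_ne_zero.2 hK1) (by rw [hdet]; exact isUnit_iff_ne_zero.2 hK2)
  rw [hdet, hdet, aux_perturb A₁ A₂ _ _ _ _ _ _ hG1 hG2 hA1 hA2, aux_det_two] at key
  have hent : ∀ (r c : Fin N → ℂ), (replicateRow (Fin 1) r * replicateCol (Fin 1) c) 0 0
      = r ⬝ᵥ c := by
    intro r c; simp [Matrix.mul_apply, dotProduct]
  have hent2 : ∀ (r v : Fin N → ℂ),
      replicateCol (Fin 1) (replicateRow (Fin 1) r *ᵥ v) 0 0 = r ⬝ᵥ v := fun _ _ => rfl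
  simp only [← replicateCol_mulVec, hent2, Matrix.sub_apply, Matrix.neg_apply, hent,
    Matrix.one_apply_eq] at key
  have hτ : (1 + A₁ * A₂).det ≠ 0 := hGd.ne_zero
  unfold Kz K₁z K₂z pz qz rz sz tauD shA₁ shA₂
  unfold β₁z β₂z at *
  rw [div_eq_iff hτ, ← mul_inv]
  refine Eq.trans ?_ (mul_assoc _ _ _).symm
  rw [eq_inv_mul_iff_mul_eq₀ (mul_ne_zero hK1 hK2)]
  refine key.trans ?_
  ring
end

section
/- In the soliton matrix setup, for any ζ ∈ ℂ such that L₁ − ζ, L₁ + ζ, L₂ − ζ, L₂ + ζ are invertible, 1 − β₁ζℓ₁ ≠ 0, 1 − β₂ζℓ₂ ≠ 0, and 1 + A₁^ζ A₂^ζ is invertible, the quantity p + s is invariant under the shift: p^ζ + s^ζ = p + s, where X^ζ denotes the value of X computed from the shifted matrices A₁^ζ, A₂^ζ. -/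
open Matrix

/-- The sum `p + s` does not depend on the solution of the rank-one conditions at all. -/
lemma p_add_s_const {N : ℕ} (D₁ D₂ : Mat N) (ℓ₁ ℓ₂ β₁ β₂ : Fin N → ℂ) (A₁ A₂ : Mat N)
    (h1 : (D₂ - Matrix.vecMulVec ℓ₁ β₁) * A₁ = A₁ * D₁)
    (h2 : (D₁ - Matrix.vecMulVec ℓ₂ β₂) * A₂ = A₂ * D₂)
    (hG : IsUnit (1 + A₁ * A₂)) :
    pD β₁ ℓ₁ A₁ A₂ + sD β₂ ℓ₂ A₁ A₂ = 2 - β₁ ⬝ᵥ ℓ₁ - β₂ ⬝ᵥ ℓ₂ := by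
  have hd : IsUnit (1 + A₁ * A₂).det := (Matrix.isUnit_iff_isUnit_det _).1 hG
  have hd2 : IsUnit (1 + A₂ * A₁).det := by
    rw [Matrix.det_one_add_mul_comm]; exact hd
  have g1 : (1 + A₁ * A₂) * G₁D A₁ A₂ = 1 := Matrix.mul_nonsing_inv _ hd
  have g2 : (1 + A₂ * A₁) * G₂D A₁ A₂ = 1 := Matrix.mul_nonsing_inv _ hd2
  have g2l : G₂D A₁ A₂ * (1 + A₂ * A₁) = 1 := Matrix.nonsing_inv_mul _ hd2
  have g1l : G₁D A₁ A₂ * (1 + A₁ * A₂) = 1 := Matrix.nonsing_inv_mul _ hd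
  have tr : ∀ (ℓ β : Fin N → ℂ) (G : Mat N),
      β ⬝ᵥ (G *ᵥ ℓ) = (Matrix.vecMulVec ℓ β * G).trace := by
    intro ℓ β G
    rw [Matrix.trace_mul_comm, Matrix.mul_vecMulVec, Matrix.trace_vecMulVec, dotProduct_comm]
  have tr0 : ∀ (ℓ β : Fin N → ℂ), β ⬝ᵥ ℓ = (Matrix.vecMulVec ℓ β).trace := by
    intro ℓ β
    rw [Matrix.trace_vecMulVec, dotProduct_comm]
  unfold pD sD
  rw [tr, tr, tr0, tr0]
  generalize G₁D A₁ A₂ = G₁ at *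
  generalize G₂D A₁ A₂ = G₂ at *
  generalize Matrix.vecMulVec ℓ₁ β₁ = V₁ at *
  generalize Matrix.vecMulVec ℓ₂ β₂ = V₂ at *
  have c1 : A₂ * G₁ = G₂ * A₂ := by
    calc A₂ * G₁ = (G₂ * (1 + A₂ * A₁)) * (A₂ * G₁) := by rw [g2l, one_mul]
      _ = G₂ * A₂ * ((1 + A₁ * A₂) * G₁) := by noncomm_ring
      _ = G₂ * A₂ := by rw [g1, mul_one]
  have c2 : A₁ * G₂ = G₁ * A₁ := by
    calc A₁ * G₂ = (G₁ * (1 + A₁ * A₂)) * (A₁ * G₂) := by rw [g1l, one_mul]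
      _ = G₁ * A₁ * ((1 + A₂ * A₁) * G₂) := by noncomm_ring
      _ = G₁ * A₁ := by rw [g2, mul_one]
  have e1 : V₁ * A₁ = D₂ * A₁ - A₁ * D₁ := by rw [← h1]; noncomm_ring
  have e2 : V₂ * A₂ = D₁ * A₂ - A₂ * D₂ := by rw [← h2]; noncomm_ring
  have f1 : V₁ = V₁ * G₁ + (D₂ * (A₁ * A₂ * G₁) - A₁ * (D₁ * (A₂ * G₁))) := by
    calc V₁ = V₁ * ((1 + A₁ * A₂) * G₁) := by rw [g1, mul_one]
      _ = V₁ * G₁ + (V₁ * A₁) * A₂ * G₁ := by noncomm_ring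
      _ = _ := by rw [e1]; noncomm_ring
  have f2 : V₂ = V₂ * G₂ + (D₁ * (A₂ * A₁ * G₂) - A₂ * (D₂ * (A₁ * G₂))) := by
    calc V₂ = V₂ * ((1 + A₂ * A₁) * G₂) := by rw [g2, mul_one]
      _ = V₂ * G₂ + (V₂ * A₂) * A₁ * G₂ := by noncomm_ring
      _ = _ := by rw [e2]; noncomm_ring
  have t1 : (A₁ * (D₁ * (A₂ * G₁))).trace = (D₁ * (A₂ * A₁ * G₂)).trace := by
    rw [Matrix.trace_mul_comm, mul_assoc, mul_assoc, mul_assoc, ← c2]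
  have t2 : (A₂ * (D₂ * (A₁ * G₂))).trace = (D₂ * (A₁ * A₂ * G₁)).trace := by
    rw [Matrix.trace_mul_comm, mul_assoc, mul_assoc, mul_assoc, ← c1]
  have u1 := congrArg Matrix.trace f1
  have u2 := congrArg Matrix.trace f2
  rw [Matrix.trace_add, Matrix.trace_sub] at u1 u2
  linear_combination u1 + u2 - t1 - t2

/-- The shift factors commute with the diagonal matrix. -/
lemma shift_comm {N : ℕ} (D X Y A V : Mat N) (D' : Mat N) (h : (D' - V) * A = A * D)
    (hX : Commute D X) (hY : Commute D Y) : (D' - V) * (A * X * Y⁻¹) = A * X * Y⁻¹ * D := by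
  have hY' : D * Y⁻¹ = Y⁻¹ * D := by
    by_cases hu : IsUnit Y.det
    · have a := Matrix.nonsing_inv_mul _ hu
      have b := Matrix.mul_nonsing_inv _ hu
      calc D * Y⁻¹ = (Y⁻¹ * Y) * D * Y⁻¹ := by rw [a, one_mul]
        _ = Y⁻¹ * (D * Y) * Y⁻¹ := by rw [hY.eq]; simp only [mul_assoc]
        _ = Y⁻¹ * D * (Y * Y⁻¹) := by simp only [mul_assoc]
        _ = Y⁻¹ * D := by rw [b, mul_one]
    · rw [Matrix.nonsing_inv_apply_not_isUnit _ hu]; simp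
  calc (D' - V) * (A * X * Y⁻¹) = ((D' - V) * A) * X * Y⁻¹ := by simp only [mul_assoc]
    _ = A * (D * X) * Y⁻¹ := by rw [h]; simp only [mul_assoc]
    _ = A * X * (D * Y⁻¹) := by rw [hX.eq]; simp only [mul_assoc]
    _ = A * X * Y⁻¹ * D := by rw [hY']; simp only [mul_assoc]

/-- `p + s` is invariant under the `ζ`-shift: `p^ζ + s^ζ = p + s`. -/
theorem soliton_p_plus_s_invariant {N : ℕ} (hN : 1 ≤ N)
    (l₁ l₂ ℓ₁ ℓ₂ β₁ β₂ : Fin N → ℂ) (A₁ A₂ : Mat N)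
    (h1 : (Dg l₂ - Matrix.vecMulVec ℓ₁ β₁) * A₁ = A₁ * Dg l₁)
    (h2 : (Dg l₁ - Matrix.vecMulVec ℓ₂ β₂) * A₂ = A₂ * Dg l₂)
    (hG : IsUnit (1 + A₁ * A₂))
    (ζ : ℂ)
    (hζ1 : IsUnit (Dg l₁ - ζ • (1 : Mat N))) (hζ2 : IsUnit (Dg l₁ + ζ • (1 : Mat N)))
    (hζ3 : IsUnit (Dg l₂ - ζ • (1 : Mat N))) (hζ4 : IsUnit (Dg l₂ + ζ • (1 : Mat N)))
    (hK1 : 1 - β₁z l₂ β₁ ζ ⬝ᵥ ℓ₁ ≠ 0) (hK2 : 1 - β₂z l₁ β₂ ζ ⬝ᵥ ℓ₂ ≠ 0)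
    (hGζ : IsUnit (1 + shA₁ l₁ ζ A₁ * shA₂ l₂ ζ A₂)) :
    pD β₁ ℓ₁ (shA₁ l₁ ζ A₁) (shA₂ l₂ ζ A₂) + sD β₂ ℓ₂ (shA₁ l₁ ζ A₁) (shA₂ l₂ ζ A₂)
      = pD β₁ ℓ₁ A₁ A₂ + sD β₂ ℓ₂ A₁ A₂ := by
  have cz : ∀ l : Fin N → ℂ, Commute (Dg l) (ζ • (1 : Mat N)) := fun l =>
    (Commute.one_right _).smul_right ζ
  have ca : ∀ l : Fin N → ℂ, Commute (Dg l) (Dg l + ζ • (1 : Mat N)) := fun l =>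
    (Commute.refl _).add_right (cz l)
  have cs : ∀ l : Fin N → ℂ, Commute (Dg l) (Dg l - ζ • (1 : Mat N)) := fun l =>
    (Commute.refl _).sub_right (cz l)
  rw [p_add_s_const _ _ ℓ₁ ℓ₂ β₁ β₂ A₁ A₂ h1 h2 hG]
  exact p_add_s_const (Dg l₁) (Dg l₂) ℓ₁ ℓ₂ β₁ β₂ _ _
    (shift_comm _ _ _ _ _ _ h1 (ca l₁) (cs l₁)) (shift_comm _ _ _ _ _ _ h2 (cs l₂) (ca l₂)) hGζ
end

section
/- In the soliton matrix setup, let ξ, η ∈ ℂ with ξ ≠ η be such that L₁ ± ξ, L₂ ± ξ, L₁ ± η, L₂ ± η are all invertible, 1 − β₁ηℓ₁ ≠ 0, 1 − β₂ηℓ₂ ≠ 0, and 1 + A₁^η A₂^η is invertible. Then the η-shift acts on the ξ-deformed scalars by: (τ^η/τ)(p_ξ^η − p_ξ) = (2η·K_η/(ξ − η))·(p_ξ q_η r_η − q_ξ p_η r_η); (τ^η/τ)(q_ξ^η − q_ξ) = (2η·K_η/(ξ − η))·(q_ξ p_η s_η − p_ξ q_η s_η); (τ^η/τ)(r_ξ^η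 − r_ξ) = (2η·K_η/(ξ − η))·(r_ξ p_η s_η − s_ξ p_η r_η); (τ^η/τ)(s_ξ^η − s_ξ) = (2η·K_η/(ξ − η))·(s_ξ q_η r_η − r_ξ q_η s_η), where X^η denotes the value of X computed from the shifted matrices A₁^η, A₂^η. -/
open Matrix

/-- matrix determinant lemma -/
theorem aux_det {N : ℕ} (H G : Mat N) (hG : H * G = 1) (u v : Fin N → ℂ) :
    (H - vecMulVec u v).det = H.det * (1 - v ⬝ᵥ (G *ᵥ u)) := by
  have e : H - vecMulVec u v = H * (1 + vecMulVec (-(G *ᵥ u)) v) := by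
    rw [mul_add, mul_vecMulVec, mulVec_neg, mulVec_mulVec, hG, one_mulVec, neg_vecMulVec, mul_one]
    abel
  rw [e, det_mul, vecMulVec_eq Unit, det_one_add_replicateCol_mul_replicateRow, dotProduct_neg]
  ring

/-- rank-one update of the product of the shifted matrices -/
theorem aux_prod {N : ℕ} (A₁ A₂ C₁ D₁ C₂ D₂ R P P₂ : Mat N) (ℓ β : Fin N → ℂ) (e K : ℂ)
    (hD₁ : D₁ = C₁ + e • 1) (hD₂ : D₂ = C₂ + e • 1)
    (hR : C₁ * R = 1) (hR' : R * C₁ = 1) (hP : D₁ * P = 1) (hP' : P * D₁ = 1) (hP₂ : D₂ * P₂ = 1)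
    (h : (D₁ - vecMulVec ℓ β) * A₂ = A₂ * D₂)
    (hK : K * (1 - (β ᵥ* P) ⬝ᵥ ℓ) = 1) :
    (A₁ * D₁ * R) * (A₂ * C₂ * P₂)
      = A₁ * A₂ - (e * K) • vecMulVec (A₁ *ᵥ (R *ᵥ ℓ)) ((β ᵥ* P) ᵥ* A₂) := by
  set E := vecMulVec ℓ β with hE
  set x := (β ᵥ* P) ⬝ᵥ ℓ with hx
  have hEE : E * P * E = x • E := by
    rw [hE, vecMulVec_mul, vecMulVec_mul_vecMulVec, vecMulVec_smul]
  have hN : (P + K • (P * E * P)) * (D₁ - E) = 1 := by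
    have : (P + K • (P * E * P)) * (D₁ - E)
        = P * D₁ - P * E + K • (P * E * (P * D₁)) - K • (P * (E * P * E)) := by
      simp only [add_mul, mul_sub, smul_mul_assoc, mul_assoc]; abel
    rw [this, hP', hEE, mul_one, mul_smul_comm]
    have : (1 : Mat N) - P * E + K • (P * E) - K • (x • (P * E))
      = 1 + (K * (1 - x) - 1) • (P * E) := by module
    rw [this, hK]; simp
  have hAP : A₂ * P₂ = (P + K • (P * E * P)) * A₂ := by
    calc A₂ * P₂ = ((P + K • (P * E * P)) * (D₁ - E)) * A₂ * P₂ := by rw [hN, one_mul]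
      _ = (P + K • (P * E * P)) * ((D₁ - E) * A₂) * P₂ := by simp only [mul_assoc]
      _ = (P + K • (P * E * P)) * A₂ * (D₂ * P₂) := by rw [h]; simp only [mul_assoc]
      _ = _ := by rw [hP₂, mul_one]
  have hC₂ : A₂ * C₂ * P₂ = A₂ - e • ((P + K • (P * E * P)) * A₂) := by
    have : C₂ = D₂ - e • 1 := by rw [hD₂]; abel
    rw [this, mul_assoc, sub_mul, hP₂, mul_sub, mul_one, smul_mul_assoc, one_mul, mul_smul_comm, hAP]
  have hDR : D₁ * R = 1 + e • R := by
    rw [hD₁, add_mul, hR, smul_mul_assoc, one_mul]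
  have hRP : R = P + e • (R * P) := by
    calc R = R * (D₁ * P) := by rw [hP, mul_one]
      _ = (R * C₁) * P + e • (R * P) := by
        rw [hD₁, add_mul, mul_add, smul_mul_assoc, one_mul, mul_smul_comm, mul_assoc]
      _ = _ := by rw [hR', one_mul]
  have hv : vecMulVec (A₁ *ᵥ (R *ᵥ ℓ)) ((β ᵥ* P) ᵥ* A₂) = A₁ * (R * E * P) * A₂ := by
    simp only [hE, mul_vecMulVec, vecMulVec_mul]
  have key : (1 + e • R) * (1 - e • (P + K • (P * E * P))) = 1 - (e * K) • (R * E * P) := by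
    have h2 : R * E * P = P * E * P + e • (R * P * E * P) := by
      conv_lhs => rw [hRP]
      simp only [add_mul, smul_mul_assoc]
    rw [h2]
    conv_lhs => rw [mul_sub, mul_one, add_mul, one_mul]
    have h3 : e • R * e • (P + K • (P * E * P))
       = (e * e) • (R * P) + (e * e * K) • (R * P * E * P) := by
      simp only [smul_mul_assoc, mul_smul_comm, mul_add, smul_add, smul_smul, mul_assoc]
      module
    rw [h3]
    have h4 : e • R = e • P + (e * e) • (R * P) := by
      conv_lhs => rw [hRP]
      module
    rw [h4]
    module
  rw [hC₂, hv, mul_assoc A₁ D₁ R, hDR]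
  calc _ = A₁ * ((1 + e • R) * (1 - e • (P + K • (P * E * P)))) * A₂ := by
        simp only [mul_assoc, sub_mul, one_mul, smul_mul_assoc]
    _ = _ := by
        rw [key, mul_sub, sub_mul, mul_one, mul_smul_comm, smul_mul_assoc]

/-- action of the inverse of a rank-one update -/
theorem aux_sm {N : ℕ} (H G H' G' : Mat N) (u v : Fin N → ℂ) (c : ℂ)
    (hG : G * H = 1) (hG' : H' * G' = 1) (hH : H' = H - c • vecMulVec u v) (w ℓ : Fin N → ℂ) :
    (1 - c * (v ⬝ᵥ (G *ᵥ u))) * (w ⬝ᵥ (G' *ᵥ ℓ) - w ⬝ᵥ (G *ᵥ ℓ))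
      = c * (v ⬝ᵥ (G *ᵥ ℓ)) * (w ⬝ᵥ (G *ᵥ u)) := by
  set z := G' *ᵥ ℓ with hz
  have e1 : H *ᵥ z - (c * (v ⬝ᵥ z)) • u = ℓ := by
    have : H' *ᵥ z = ℓ := by rw [hz, mulVec_mulVec, hG', one_mulVec]
    rw [hH, sub_mulVec, smul_mulVec, vecMulVec_mulVec] at this
    rw [← this]
    simp [smul_smul]
  have e2 : z = G *ᵥ ℓ + (c * (v ⬝ᵥ z)) • (G *ᵥ u) := by
    rw [← e1, mulVec_sub, mulVec_mulVec, hG, one_mulVec, mulVec_smul]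
    simp
  have f : ∀ y : Fin N → ℂ, y ⬝ᵥ z = y ⬝ᵥ (G *ᵥ ℓ) + (c * (v ⬝ᵥ z)) * (y ⬝ᵥ (G *ᵥ u)) := by
    intro y
    conv_lhs => rw [e2]
    rw [dotProduct_add, dotProduct_smul, smul_eq_mul]
  have fv := f v
  have fw := f w
  linear_combination (1 - c * (v ⬝ᵥ (G *ᵥ u))) * fw + c * (w ⬝ᵥ (G *ᵥ u)) * fv

/-- the determinant identity -/
theorem aux_key {N : ℕ} (A₁ A₂ C₁ C₂ R₁ R₂ G : Mat N) (ℓ₁ ℓ₂ β₁ β₂ : Fin N → ℂ) (K t : ℂ)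
    (h1 : (C₂ - vecMulVec ℓ₁ β₁) * A₁ = A₁ * C₁)
    (h2 : (C₁ - vecMulVec ℓ₂ β₂) * A₂ = A₂ * C₂)
    (hR₁ : C₁ * R₁ = 1) (hR₂ : C₂ * R₂ = 1) (hR₂' : R₂ * C₂ = 1)
    (hG : (1 + A₁ * A₂) * G = 1)
    (hK : K * (1 - (β₁ ᵥ* R₂) ⬝ᵥ ℓ₁) = 1) :
    (1 - (β₂ ᵥ* A₂ - t • β₁) ⬝ᵥ (G *ᵥ (A₁ *ᵥ (R₁ *ᵥ ℓ₂))))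
      = K * (1 - (β₁ ᵥ* R₂) ⬝ᵥ (G *ᵥ (ℓ₁ - t • (A₁ *ᵥ ℓ₂)))) := by
  set u := A₁ *ᵥ (R₁ *ᵥ ℓ₂) with hu
  have hMu : (C₂ - vecMulVec ℓ₁ β₁) *ᵥ u = A₁ *ᵥ ℓ₂ := by
    rw [hu, mulVec_mulVec, h1, mulVec_mulVec, mul_assoc, hR₁, mul_one]
  have hA : A₂ * C₂ = C₁ * A₂ - vecMulVec ℓ₂ β₂ * A₂ := by rw [← h2, sub_mul]
  have hm : (C₂ - vecMulVec ℓ₁ β₁) * ((1 + A₁ * A₂) - vecMulVec u (β₂ ᵥ* A₂ - t • β₁))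
      = ((1 + A₁ * A₂) - vecMulVec (ℓ₁ - t • (A₁ *ᵥ ℓ₂)) (β₁ ᵥ* R₂)) * C₂ := by
    have l : (C₂ - vecMulVec ℓ₁ β₁) * ((1 + A₁ * A₂) - vecMulVec u (β₂ ᵥ* A₂ - t • β₁))
        = C₂ - vecMulVec ℓ₁ β₁ + A₁ * C₁ * A₂
          - vecMulVec (A₁ *ᵥ ℓ₂) (β₂ ᵥ* A₂) + t • vecMulVec (A₁ *ᵥ ℓ₂) β₁ := by
      rw [mul_sub, mul_vecMulVec, hMu, mul_add, mul_one, ← mul_assoc, h1, vecMulVec_sub,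
        vecMulVec_smul]
      abel
    have r : ((1 + A₁ * A₂) - vecMulVec (ℓ₁ - t • (A₁ *ᵥ ℓ₂)) (β₁ ᵥ* R₂)) * C₂
        = C₂ + A₁ * (A₂ * C₂) - vecMulVec ℓ₁ β₁ + t • vecMulVec (A₁ *ᵥ ℓ₂) β₁ := by
      rw [sub_mul, vecMulVec_mul, vecMul_vecMul, hR₂', vecMul_one, add_mul, one_mul, mul_assoc,
        sub_vecMulVec, smul_vecMulVec]
      abel
    rw [l, r, hA, mul_sub, vecMulVec_mul, mul_vecMulVec, mul_assoc]
    abel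
  have hd := congrArg Matrix.det hm
  rw [det_mul, det_mul, aux_det C₂ R₂ hR₂, aux_det _ G hG, aux_det _ G hG] at hd
  have hH0 : (1 + A₁ * A₂).det ≠ 0 := by
    intro h0
    have := congrArg Matrix.det hG
    rw [det_mul, h0] at this
    simp at this
  have hC0 : C₂.det ≠ 0 := by
    intro h0
    have := congrArg Matrix.det hR₂
    rw [det_mul, h0] at this
    simp at this
  rw [dotProduct_mulVec β₁ R₂] at hd
  have hd' := mul_left_cancel₀ (mul_ne_zero hH0 hC0) (b :=
    (1 - (β₁ ᵥ* R₂) ⬝ᵥ ℓ₁) * (1 - (β₂ ᵥ* A₂ - t • β₁) ⬝ᵥ (G *ᵥ u)))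
    (c := (1 - (β₁ ᵥ* R₂) ⬝ᵥ (G *ᵥ (ℓ₁ - t • (A₁ *ᵥ ℓ₂))))) (by linear_combination hd)
  rw [← hd', ← mul_assoc, hK, one_mul]

/-- the two-parameter identity for `β₁ξ G u` -/
theorem aux_wu {N : ℕ} (A₁ A₂ C₁ C₂ F₂ X₂ R₁ R₂ G : Mat N) (ℓ₁ ℓ₂ β₁ β₂ : Fin N → ℂ) (K d : ℂ)
    (h1 : (C₂ - vecMulVec ℓ₁ β₁) * A₁ = A₁ * C₁)
    (h2 : (C₁ - vecMulVec ℓ₂ β₂) * A₂ = A₂ * C₂)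
    (hF : F₂ = C₂ - d • 1) (hX : X₂ * F₂ = 1)
    (hR₁ : C₁ * R₁ = 1) (hR₂ : C₂ * R₂ = 1) (hR₂' : R₂ * C₂ = 1)
    (hG : (1 + A₁ * A₂) * G = 1) (hG' : G * (1 + A₁ * A₂) = 1)
    (hK : K * (1 - (β₁ ᵥ* R₂) ⬝ᵥ ℓ₁) = 1) :
    d * ((β₁ ᵥ* X₂) ⬝ᵥ (G *ᵥ (A₁ *ᵥ (R₁ *ᵥ ℓ₂))))
      = K * (((β₁ ᵥ* X₂) ⬝ᵥ (G *ᵥ (A₁ *ᵥ ℓ₂))) * (1 - (β₁ ᵥ* R₂) ⬝ᵥ (G *ᵥ ℓ₁))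
        - (1 - (β₁ ᵥ* X₂) ⬝ᵥ (G *ᵥ ℓ₁)) * ((β₁ ᵥ* R₂) ⬝ᵥ (G *ᵥ (A₁ *ᵥ ℓ₂)))) := by
  have k0 := aux_key A₁ A₂ C₁ C₂ R₁ R₂ G ℓ₁ ℓ₂ β₁ β₂ K 0 h1 h2 hR₁ hR₂ hR₂' hG hK
  have k1 := aux_key A₁ A₂ C₁ C₂ R₁ R₂ G ℓ₁ ℓ₂ β₁ β₂ K 1 h1 h2 hR₁ hR₂ hR₂' hG hK
  simp only [zero_smul, sub_zero, one_smul, sub_dotProduct, mulVec_sub, dotProduct_sub] at k0 k1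
  set u := A₁ *ᵥ (R₁ *ᵥ ℓ₂) with hu
  set H := 1 + A₁ * A₂ with hH
  have hMu : (C₂ - vecMulVec ℓ₁ β₁) *ᵥ u = A₁ *ᵥ ℓ₂ := by
    rw [hu, mulVec_mulVec, h1, mulVec_mulVec, mul_assoc, hR₁, mul_one]
  have hA : C₁ * A₂ = A₂ * C₂ + vecMulVec ℓ₂ β₂ * A₂ := by rw [← h2, sub_mul]; abel
  have hMH : (C₂ - vecMulVec ℓ₁ β₁) * H
      = H * C₂ - vecMulVec ℓ₁ β₁ + vecMulVec (A₁ *ᵥ ℓ₂) (β₂ ᵥ* A₂) := by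
    rw [hH, mul_add, mul_one, ← mul_assoc, h1, mul_assoc, hA, mul_add, vecMulVec_mul,
      mul_vecMulVec, add_mul, one_mul, mul_assoc]
    abel
  have hMH' : (C₂ - vecMulVec ℓ₁ β₁ - d • 1) * H
      = H * F₂ - vecMulVec ℓ₁ β₁ + vecMulVec (A₁ *ᵥ ℓ₂) (β₂ ᵥ* A₂) := by
    rw [sub_mul, hMH, hF, mul_sub, smul_mul_assoc, mul_smul_comm, one_mul, mul_one]
    abel
  set w := (β₁ ᵥ* X₂) ᵥ* G with hw
  have hwd : ∀ y, (β₁ ᵥ* X₂) ⬝ᵥ (G *ᵥ y) = w ⬝ᵥ y := by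
    intro y; rw [hw, dotProduct_mulVec]
  simp only [hwd]
  have hwHF : w ᵥ* (H * F₂) = β₁ := by
    rw [hw, ← vecMul_vecMul, vecMul_vecMul _ G H, hG', vecMul_one, vecMul_vecMul, hX, vecMul_one]
  have hrow : w ᵥ* (C₂ - vecMulVec ℓ₁ β₁ - d • 1)
      = (1 - w ⬝ᵥ ℓ₁) • (β₁ ᵥ* G) + (w ⬝ᵥ (A₁ *ᵥ ℓ₂)) • ((β₂ ᵥ* A₂) ᵥ* G) := by
    have : w ᵥ* ((C₂ - vecMulVec ℓ₁ β₁ - d • 1) * H) ᵥ* G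
        = w ᵥ* (C₂ - vecMulVec ℓ₁ β₁ - d • 1) := by
      rw [vecMul_vecMul, mul_assoc, hG, mul_one]
    rw [← this, hMH', vecMul_add, vecMul_sub, hwHF, vecMul_vecMulVec, vecMul_vecMulVec,
      add_vecMul, sub_vecMul, smul_vecMul, smul_vecMul, sub_smul, one_smul]
  have hs := congrArg (fun r => r ⬝ᵥ u) hrow
  simp only [add_dotProduct, smul_dotProduct, smul_eq_mul] at hs
  rw [← dotProduct_mulVec w _ u, sub_mulVec, hMu, dotProduct_sub, smul_mulVec, one_mulVec,
    dotProduct_smul, smul_eq_mul, ← dotProduct_mulVec β₁ G u,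
    ← dotProduct_mulVec (β₂ ᵥ* A₂) G u] at hs
  linear_combination -hs + (w ⬝ᵥ (A₁ *ᵥ ℓ₂)) * k0 - (1 - w ⬝ᵥ ℓ₁) * (k1 - k0)

theorem aux_β₁z_neg {N : ℕ} (l β : Fin N → ℂ) (ζ : ℂ) : β₁z l β (-ζ) = β₂z l β ζ := by
  simp [β₁z, β₂z]

theorem aux_β₂z_neg {N : ℕ} (l β : Fin N → ℂ) (ζ : ℂ) : β₂z l β (-ζ) = β₁z l β ζ := by
  simp [β₁z, β₂z, sub_eq_add_neg]

theorem aux_shA₁_neg {N : ℕ} (l : Fin N → ℂ) (ζ : ℂ) (A : Mat N) :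
    shA₁ l (-ζ) A = shA₂ l ζ A := by
  simp [shA₁, shA₂, sub_eq_add_neg]

theorem aux_shA₂_neg {N : ℕ} (l : Fin N → ℂ) (ζ : ℂ) (A : Mat N) :
    shA₂ l (-ζ) A = shA₁ l ζ A := by
  simp [shA₁, shA₂, sub_eq_add_neg]

/-- the formulae for `p_ξ` and `q_ξ`; those for `r_ξ`, `s_ξ` follow by exchanging the indices -/
theorem aux_core {N : ℕ}
    (l₁ l₂ ℓ₁ ℓ₂ β₁ β₂ : Fin N → ℂ) (A₁ A₂ : Mat N)
    (h1 : (Dg l₂ - Matrix.vecMulVec ℓ₁ β₁) * A₁ = A₁ * Dg l₁)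
    (h2 : (Dg l₁ - Matrix.vecMulVec ℓ₂ β₂) * A₂ = A₂ * Dg l₂)
    (hG : IsUnit (1 + A₁ * A₂))
    (ξ η : ℂ) (hξη : ξ ≠ η)
    (hξ3 : IsUnit (Dg l₂ - ξ • (1 : Mat N)))
    (hη1 : IsUnit (Dg l₁ - η • (1 : Mat N))) (hη2 : IsUnit (Dg l₁ + η • (1 : Mat N)))
    (hη3 : IsUnit (Dg l₂ - η • (1 : Mat N))) (hη4 : IsUnit (Dg l₂ + η • (1 : Mat N)))
    (hK1 : 1 - β₁z l₂ β₁ η ⬝ᵥ ℓ₁ ≠ 0) (hK2 : 1 - β₂z l₁ β₂ η ⬝ᵥ ℓ₂ ≠ 0)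
    (hGη : IsUnit (1 + shA₁ l₁ η A₁ * shA₂ l₂ η A₂)) :
    (tauD (shA₁ l₁ η A₁) (shA₂ l₂ η A₂) / tauD A₁ A₂) *
        (pz l₂ β₁ ℓ₁ ξ (shA₁ l₁ η A₁) (shA₂ l₂ η A₂) - pz l₂ β₁ ℓ₁ ξ A₁ A₂)
      = (2 * η * Kz l₁ l₂ β₁ β₂ ℓ₁ ℓ₂ η / (ξ - η)) *
          (pz l₂ β₁ ℓ₁ ξ A₁ A₂ * qz l₂ β₁ ℓ₂ η A₁ A₂ * rz l₁ β₂ ℓ₁ η A₁ A₂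
            - qz l₂ β₁ ℓ₂ ξ A₁ A₂ * pz l₂ β₁ ℓ₁ η A₁ A₂ * rz l₁ β₂ ℓ₁ η A₁ A₂)
    ∧ (tauD (shA₁ l₁ η A₁) (shA₂ l₂ η A₂) / tauD A₁ A₂) *
        (qz l₂ β₁ ℓ₂ ξ (shA₁ l₁ η A₁) (shA₂ l₂ η A₂) - qz l₂ β₁ ℓ₂ ξ A₁ A₂)
      = (2 * η * Kz l₁ l₂ β₁ β₂ ℓ₁ ℓ₂ η / (ξ - η)) *
          (qz l₂ β₁ ℓ₂ ξ A₁ A₂ * pz l₂ β₁ ℓ₁ η A₁ A₂ * sz l₁ β₂ ℓ₂ η A₁ A₂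
            - pz l₂ β₁ ℓ₁ ξ A₁ A₂ * qz l₂ β₁ ℓ₂ η A₁ A₂ * sz l₁ β₂ ℓ₂ η A₁ A₂) := by
  have hinv : ∀ X : Mat N, IsUnit X → X * X⁻¹ = 1 ∧ X⁻¹ * X = 1 := by
    intro X hX
    rw [isUnit_iff_isUnit_det] at hX
    exact ⟨mul_nonsing_inv X hX, nonsing_inv_mul X hX⟩
  have sh1 : ∀ z : ℂ, (Dg l₂ - z • (1 : Mat N) - vecMulVec ℓ₁ β₁) * A₁
      = A₁ * (Dg l₁ - z • (1 : Mat N)) := by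
    intro z
    rw [sub_right_comm, sub_mul, h1, mul_sub, smul_mul_assoc, mul_smul_comm, one_mul, mul_one]
  have sh2 : ∀ z : ℂ, (Dg l₁ - z • (1 : Mat N) - vecMulVec ℓ₂ β₂) * A₂
      = A₂ * (Dg l₂ - z • (1 : Mat N)) := by
    intro z
    rw [sub_right_comm, sub_mul, h2, mul_sub, smul_mul_assoc, mul_smul_comm, one_mul, mul_one]
  have sh2' : (Dg l₁ + η • (1 : Mat N) - vecMulVec ℓ₂ β₂) * A₂
      = A₂ * (Dg l₂ + η • (1 : Mat N)) := by
    simpa using sh2 (-η)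
  obtain ⟨i1, i1'⟩ := hinv _ hη1
  obtain ⟨i2, i2'⟩ := hinv _ hη2
  obtain ⟨i3, i3'⟩ := hinv _ hη3
  obtain ⟨i4, i4'⟩ := hinv _ hη4
  obtain ⟨i5, i5'⟩ := hinv _ hξ3
  obtain ⟨g, g'⟩ := hinv _ hG
  obtain ⟨j, j'⟩ := hinv _ hGη
  have hG2 : IsUnit (1 + A₂ * A₁) := by
    rw [isUnit_iff_isUnit_det, det_one_add_mul_comm, ← isUnit_iff_isUnit_det]; exact hG
  obtain ⟨k, k'⟩ := hinv _ hG2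
  have hKK1 : K₁z l₂ β₁ ℓ₁ η * (1 - β₁z l₂ β₁ η ⬝ᵥ ℓ₁) = 1 := inv_mul_cancel₀ hK1
  have hKK2 : K₂z l₁ β₂ ℓ₂ η * (1 - β₂z l₁ β₂ η ⬝ᵥ ℓ₂) = 1 := inv_mul_cancel₀ hK2
  -- push-through
  have hGA : G₂D A₁ A₂ * A₂ = A₂ * G₁D A₁ A₂ := by
    have e : A₂ * (1 + A₁ * A₂) = (1 + A₂ * A₁) * A₂ := by noncomm_ring
    calc G₂D A₁ A₂ * A₂ = G₂D A₁ A₂ * (A₂ * (1 + A₁ * A₂)) * G₁D A₁ A₂ := by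
          rw [G₁D, mul_assoc, mul_assoc, g, mul_one]
      _ = _ := by rw [e, G₂D, ← mul_assoc, k', one_mul]
  have hG2e : G₂D A₁ A₂ = 1 - A₂ * G₁D A₁ A₂ * A₁ := by
    rw [← hGA, eq_sub_iff_add_eq, mul_assoc]
    calc _ = G₂D A₁ A₂ * (1 + A₂ * A₁) := by rw [mul_add, mul_one]
      _ = 1 := k'
  have wu := aux_wu A₁ A₂ _ _ (Dg l₂ - ξ • (1 : Mat N)) _ _ _ _ ℓ₁ ℓ₂ β₁ β₂
    (K₁z l₂ β₁ ℓ₁ η) (ξ - η) (sh1 η) (sh2 η) (by module) i5' i1 i3 i3' g g' hKK1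
  have pr := aux_prod A₁ A₂ _ _ (Dg l₂ - η • (1 : Mat N)) _ _ _ _ ℓ₂ β₂ (2 * η) (K₂z l₁ β₂ ℓ₂ η)
    (by module) (by module) i1 i1' i2 i2' i4 sh2' hKK2
  change shA₁ l₁ η A₁ * shA₂ l₂ η A₂ = _ at pr
  set u := A₁ *ᵥ ((Dg l₁ - η • (1 : Mat N))⁻¹ *ᵥ ℓ₂) with hu
  set v := (β₂ ᵥ* (Dg l₁ + η • (1 : Mat N))⁻¹) ᵥ* A₂ with hv
  set K₂ := K₂z l₁ β₂ ℓ₂ η with hK₂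
  set K₁ := K₁z l₂ β₁ ℓ₁ η with hK₁
  have hH : 1 + shA₁ l₁ η A₁ * shA₂ l₂ η A₂
      = (1 + A₁ * A₂) - (2 * η * K₂) • vecMulVec u v := by rw [pr]; abel
  have sm := aux_sm _ _ _ _ u v (2 * η * K₂) g' j hH (β₁z l₂ β₁ ξ)
  change ∀ ℓ, (1 - 2 * η * K₂ * (v ⬝ᵥ (G₁D A₁ A₂ *ᵥ u))) *
    (_ ⬝ᵥ (G₁D (shA₁ l₁ η A₁) (shA₂ l₂ η A₂) *ᵥ ℓ) - _ ⬝ᵥ (G₁D A₁ A₂ *ᵥ ℓ))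
    = 2 * η * K₂ * (v ⬝ᵥ (G₁D A₁ A₂ *ᵥ ℓ)) * (_ ⬝ᵥ (G₁D A₁ A₂ *ᵥ u)) at sm
  have hτ0 : tauD A₁ A₂ ≠ 0 := by
    rw [isUnit_iff_isUnit_det] at hG; exact hG.ne_zero
  have hτ : tauD (shA₁ l₁ η A₁) (shA₂ l₂ η A₂) / tauD A₁ A₂
      = 1 - 2 * η * K₂ * (v ⬝ᵥ (G₁D A₁ A₂ *ᵥ u)) := by
    rw [div_eq_iff hτ0, tauD, hH, ← smul_vecMulVec, aux_det _ _ g, mulVec_smul, dotProduct_smul,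
      smul_eq_mul, mul_comm]
    rfl
  have hvy : ∀ y, v ⬝ᵥ (G₁D A₁ A₂ *ᵥ y) = β₂z l₁ β₂ η ⬝ᵥ (G₂D A₁ A₂ *ᵥ (A₂ *ᵥ y)) := by
    intro y
    rw [mulVec_mulVec, hGA, ← mulVec_mulVec, dotProduct_mulVec _ A₂]
    rfl
  have hr : v ⬝ᵥ (G₁D A₁ A₂ *ᵥ ℓ₁) = rz l₁ β₂ ℓ₁ η A₁ A₂ := hvy _
  have hs : K₂ * sz l₁ β₂ ℓ₂ η A₁ A₂
      = 1 + K₂ * (v ⬝ᵥ (G₁D A₁ A₂ *ᵥ (A₁ *ᵥ ℓ₂))) := by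
    rw [sz, hG2e, sub_mulVec, one_mulVec, dotProduct_sub, ← mulVec_mulVec, ← mulVec_mulVec,
      dotProduct_mulVec _ A₂]
    change _ = 1 + K₂ * ((β₂z l₁ β₂ η ᵥ* A₂) ⬝ᵥ _)
    linear_combination hKK2
  have hA₁ : shA₁ l₁ η A₁ *ᵥ ℓ₂ = A₁ *ᵥ ℓ₂ + (2 * η) • u := by
    have e : Dg l₁ + η • (1 : Mat N) = (Dg l₁ - η • (1 : Mat N)) + (2 * η) • (1 : Mat N) := by
      module
    rw [shA₁, e, mul_assoc, add_mul, i1, smul_mul_assoc, one_mul, ← mulVec_mulVec, add_mulVec,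
      one_mulVec, smul_mulVec, mulVec_add, mulVec_smul]
  have hξη' : ξ - η ≠ 0 := sub_ne_zero.mpr hξη
  change (ξ - η) * (β₁z l₂ β₁ ξ ⬝ᵥ (G₁D A₁ A₂ *ᵥ u)) = K₁ *
    (qz l₂ β₁ ℓ₂ ξ A₁ A₂ * pz l₂ β₁ ℓ₁ η A₁ A₂
      - pz l₂ β₁ ℓ₁ ξ A₁ A₂ * qz l₂ β₁ ℓ₂ η A₁ A₂) at wu
  have hKz : Kz l₁ l₂ β₁ β₂ ℓ₁ ℓ₂ η = K₁ * K₂ := rfl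
  have s1 := sm ℓ₁
  have s2 := sm (A₁ *ᵥ ℓ₂)
  have s3 := sm u
  rw [hr] at s1
  rw [hτ, hKz]
  constructor
  · rw [div_mul_eq_mul_div, eq_div_iff hξη']
    have : pz l₂ β₁ ℓ₁ ξ (shA₁ l₁ η A₁) (shA₂ l₂ η A₂) - pz l₂ β₁ ℓ₁ ξ A₁ A₂
        = -(β₁z l₂ β₁ ξ ⬝ᵥ (G₁D (shA₁ l₁ η A₁) (shA₂ l₂ η A₂) *ᵥ ℓ₁)
          - β₁z l₂ β₁ ξ ⬝ᵥ (G₁D A₁ A₂ *ᵥ ℓ₁)) := by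
      rw [pz, pz]; ring
    rw [this]
    linear_combination -(ξ - η) * s1 - (2 * η * K₂ * rz l₁ β₂ ℓ₁ η A₁ A₂) * wu
  · rw [div_mul_eq_mul_div, eq_div_iff hξη']
    have : qz l₂ β₁ ℓ₂ ξ (shA₁ l₁ η A₁) (shA₂ l₂ η A₂) - qz l₂ β₁ ℓ₂ ξ A₁ A₂
        = (β₁z l₂ β₁ ξ ⬝ᵥ (G₁D (shA₁ l₁ η A₁) (shA₂ l₂ η A₂) *ᵥ (A₁ *ᵥ ℓ₂))
          - β₁z l₂ β₁ ξ ⬝ᵥ (G₁D A₁ A₂ *ᵥ (A₁ *ᵥ ℓ₂)))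
          + 2 * η * (β₁z l₂ β₁ ξ ⬝ᵥ (G₁D (shA₁ l₁ η A₁) (shA₂ l₂ η A₂) *ᵥ u)) := by
      rw [qz, qz, hA₁, mulVec_add, mulVec_smul, dotProduct_add, dotProduct_smul, smul_eq_mul]
      ring
    rw [this]
    linear_combination (ξ - η) * s2 + 2 * η * (ξ - η) * s3
      + (2 * η * K₂ * sz l₁ β₂ ℓ₂ η A₁ A₂) * wu
      - 2 * η * (ξ - η) * (β₁z l₂ β₁ ξ ⬝ᵥ (G₁D A₁ A₂ *ᵥ u)) * hs

/-- action of the `η`-shift on the `ξ`-deformed scalars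
`p_ξ, q_ξ, r_ξ, s_ξ` (the two-shift 'evolution' formulae). -/
theorem soliton_two_shift_scalars {N : ℕ} (hN : 1 ≤ N)
    (l₁ l₂ ℓ₁ ℓ₂ β₁ β₂ : Fin N → ℂ) (A₁ A₂ : Mat N)
    (h1 : (Dg l₂ - Matrix.vecMulVec ℓ₁ β₁) * A₁ = A₁ * Dg l₁)
    (h2 : (Dg l₁ - Matrix.vecMulVec ℓ₂ β₂) * A₂ = A₂ * Dg l₂)
    (hG : IsUnit (1 + A₁ * A₂))
    (ξ η : ℂ) (hξη : ξ ≠ η)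
    (hξ1 : IsUnit (Dg l₁ - ξ • (1 : Mat N))) (hξ2 : IsUnit (Dg l₁ + ξ • (1 : Mat N)))
    (hξ3 : IsUnit (Dg l₂ - ξ • (1 : Mat N))) (hξ4 : IsUnit (Dg l₂ + ξ • (1 : Mat N)))
    (hη1 : IsUnit (Dg l₁ - η • (1 : Mat N))) (hη2 : IsUnit (Dg l₁ + η • (1 : Mat N)))
    (hη3 : IsUnit (Dg l₂ - η • (1 : Mat N))) (hη4 : IsUnit (Dg l₂ + η • (1 : Mat N)))
    (hK1 : 1 - β₁z l₂ β₁ η ⬝ᵥ ℓ₁ ≠ 0) (hK2 : 1 - β₂z l₁ β₂ η ⬝ᵥ ℓ₂ ≠ 0)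
    (hGη : IsUnit (1 + shA₁ l₁ η A₁ * shA₂ l₂ η A₂)) :
    (tauD (shA₁ l₁ η A₁) (shA₂ l₂ η A₂) / tauD A₁ A₂) *
        (pz l₂ β₁ ℓ₁ ξ (shA₁ l₁ η A₁) (shA₂ l₂ η A₂) - pz l₂ β₁ ℓ₁ ξ A₁ A₂)
      = (2 * η * Kz l₁ l₂ β₁ β₂ ℓ₁ ℓ₂ η / (ξ - η)) *
          (pz l₂ β₁ ℓ₁ ξ A₁ A₂ * qz l₂ β₁ ℓ₂ η A₁ A₂ * rz l₁ β₂ ℓ₁ η A₁ A₂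
            - qz l₂ β₁ ℓ₂ ξ A₁ A₂ * pz l₂ β₁ ℓ₁ η A₁ A₂ * rz l₁ β₂ ℓ₁ η A₁ A₂)
    ∧ (tauD (shA₁ l₁ η A₁) (shA₂ l₂ η A₂) / tauD A₁ A₂) *
        (qz l₂ β₁ ℓ₂ ξ (shA₁ l₁ η A₁) (shA₂ l₂ η A₂) - qz l₂ β₁ ℓ₂ ξ A₁ A₂)
      = (2 * η * Kz l₁ l₂ β₁ β₂ ℓ₁ ℓ₂ η / (ξ - η)) *
          (qz l₂ β₁ ℓ₂ ξ A₁ A₂ * pz l₂ β₁ ℓ₁ η A₁ A₂ * sz l₁ β₂ ℓ₂ η A₁ A₂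
            - pz l₂ β₁ ℓ₁ ξ A₁ A₂ * qz l₂ β₁ ℓ₂ η A₁ A₂ * sz l₁ β₂ ℓ₂ η A₁ A₂)
    ∧ (tauD (shA₁ l₁ η A₁) (shA₂ l₂ η A₂) / tauD A₁ A₂) *
        (rz l₁ β₂ ℓ₁ ξ (shA₁ l₁ η A₁) (shA₂ l₂ η A₂) - rz l₁ β₂ ℓ₁ ξ A₁ A₂)
      = (2 * η * Kz l₁ l₂ β₁ β₂ ℓ₁ ℓ₂ η / (ξ - η)) *
          (rz l₁ β₂ ℓ₁ ξ A₁ A₂ * pz l₂ β₁ ℓ₁ η A₁ A₂ * sz l₁ β₂ ℓ₂ η A₁ A₂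
            - sz l₁ β₂ ℓ₂ ξ A₁ A₂ * pz l₂ β₁ ℓ₁ η A₁ A₂ * rz l₁ β₂ ℓ₁ η A₁ A₂)
    ∧ (tauD (shA₁ l₁ η A₁) (shA₂ l₂ η A₂) / tauD A₁ A₂) *
        (sz l₁ β₂ ℓ₂ ξ (shA₁ l₁ η A₁) (shA₂ l₂ η A₂) - sz l₁ β₂ ℓ₂ ξ A₁ A₂)
      = (2 * η * Kz l₁ l₂ β₁ β₂ ℓ₁ ℓ₂ η / (ξ - η)) *
          (sz l₁ β₂ ℓ₂ ξ A₁ A₂ * qz l₂ β₁ ℓ₂ η A₁ A₂ * rz l₁ β₂ ℓ₁ η A₁ A₂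
            - rz l₁ β₂ ℓ₁ ξ A₁ A₂ * qz l₂ β₁ ℓ₂ η A₁ A₂ * sz l₁ β₂ ℓ₂ η A₁ A₂) := by
  have c1 := aux_core l₁ l₂ ℓ₁ ℓ₂ β₁ β₂ A₁ A₂ h1 h2 hG ξ η hξη hξ3 hη1 hη2 hη3 hη4 hK1 hK2 hGη
  have hG2 : IsUnit (1 + A₂ * A₁) := by
    rw [isUnit_iff_isUnit_det, det_one_add_mul_comm, ← isUnit_iff_isUnit_det]; exact hG
  have hGη2 : IsUnit (1 + shA₂ l₂ η A₂ * shA₁ l₁ η A₁) := by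
    rw [isUnit_iff_isUnit_det, det_one_add_mul_comm, ← isUnit_iff_isUnit_det]; exact hGη
  have c2 := aux_core l₂ l₁ ℓ₂ ℓ₁ β₂ β₁ A₂ A₁ h2 h1 hG2 (-ξ) (-η) (by simpa using hξη)
    (by simpa using hξ2) (by simpa using hη4) (by simpa [sub_eq_add_neg] using hη3)
    (by simpa using hη2) (by simpa [sub_eq_add_neg] using hη1)
    (by rw [aux_β₁z_neg]; exact hK2) (by rw [aux_β₂z_neg]; exact hK1)
    (by rw [aux_shA₁_neg, aux_shA₂_neg]; exact hGη2)
  have hKs : Kz l₂ l₁ β₂ β₁ ℓ₂ ℓ₁ (-η) = Kz l₁ l₂ β₁ β₂ ℓ₁ ℓ₂ η := by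
    simp only [Kz, K₁z, K₂z, aux_β₁z_neg, aux_β₂z_neg]; ring
  have hτ : ∀ X Y : Mat N, tauD Y X = tauD X Y := fun X Y => det_one_add_mul_comm _ _
  have hp : ∀ ζ (X Y : Mat N), pz l₁ β₂ ℓ₂ (-ζ) Y X = sz l₁ β₂ ℓ₂ ζ X Y := by
    intro ζ X Y; rw [pz, aux_β₁z_neg]; rfl
  have hq : ∀ ζ (X Y : Mat N), qz l₁ β₂ ℓ₁ (-ζ) Y X = rz l₁ β₂ ℓ₁ ζ X Y := by
    intro ζ X Y; rw [qz, aux_β₁z_neg]; rfl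
  have hr : ∀ ζ (X Y : Mat N), rz l₂ β₁ ℓ₂ (-ζ) Y X = qz l₂ β₁ ℓ₂ ζ X Y := by
    intro ζ X Y; rw [rz, aux_β₂z_neg]; rfl
  have hs : ∀ ζ (X Y : Mat N), sz l₂ β₁ ℓ₁ (-ζ) Y X = pz l₂ β₁ ℓ₁ ζ X Y := by
    intro ζ X Y; rw [sz, aux_β₂z_neg]; rfl
  have hc : 2 * -η * Kz l₁ l₂ β₁ β₂ ℓ₁ ℓ₂ η / (-ξ - -η)
      = 2 * η * Kz l₁ l₂ β₁ β₂ ℓ₁ ℓ₂ η / (ξ - η) := by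
    rw [← neg_div_neg_eq]; congr 1 <;> ring
  rw [aux_shA₁_neg, aux_shA₂_neg, hKs, hc] at c2
  simp only [hp, hq, hr, hs] at c2
  rw [hτ A₁ A₂, hτ (shA₁ l₁ η A₁) (shA₂ l₂ η A₂)] at c2
  refine ⟨c1.1, c1.2, ?_, ?_⟩
  · rw [c2.2]; ring
  · rw [c2.1]; ring
end

section
/- In the soliton matrix setup, let ξ, η ∈ ℂ with ξ ≠ η be such that L₁ ± ξ, L₂ ± ξ, L₁ ± η, L₂ ± η are all invertible, 1 − β₁ξℓ₁ ≠ 0, 1 − β₂ξℓ₂ ≠ 0, 1 − β₁ηℓ₁ ≠ 0, 1 − β₂ηℓ₂ ≠ 0. Then the two-shift tau-function identity holds: τ·τ^{ξη} − τ^ξ·τ^η = (4ξη·K_ξ·K_η/(ξ − η)²)·(p_ξ q_η − p_η q_ξ)·(r_η s_ξ − r_ξ s_η)·τ², where τ^ξ = det(1 + A₁^ξ A₂^ξ), τ^η = det(1 + A₁^η A₂^η) and τ^{ξη} = det(1 + A₁^{ξη} A₂^{ξη}). -/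
open Matrix

section abstract_part
variable {n m : Type*} [Fintype n] [DecidableEq n] [Fintype m] [DecidableEq m]

lemma abs_single (Λ : Matrix n n ℂ) (l : Matrix n m ℂ) (B b : Matrix m n ℂ) (X Xi : Matrix n n ℂ)
    (ζ : ℂ) (hb : b * (Λ - ζ • 1) = B) (hX : X * Xi = 1) :
    (X * (Λ - ζ • 1) - l * B).det = X.det * (1 - b * Xi * l).det * (Λ - ζ • 1).det := by
  have : X * (Λ - ζ • 1) - l * B = X * (1 - (Xi * l) * b) * (Λ - ζ • 1) := by
    rw [← hb, Matrix.mul_sub X 1, Matrix.sub_mul (X * 1), Matrix.mul_one]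
    simp only [← Matrix.mul_assoc]
    rw [hX, Matrix.one_mul]
  rw [this, det_mul, det_mul, Matrix.det_one_sub_mul_comm, Matrix.mul_assoc]

lemma abs_row (Λ Z : Matrix n n ℂ) (l : Matrix n m ℂ) (B b : Matrix m n ℂ) (Xi Xt : Matrix n n ℂ)
    (ζ : ℂ) (hZ : Z * Λ = -((Λ - l * B) * Z)) (hb : b * (Λ - ζ • 1) = B)
    (hX : Xi * (1 + Z) = 1) (hXt : (1 - Z) * Xt = 1) :
    b * Xi * ((Λ - l * B) * l)
      = ζ • (b * Xt * l) + (1 - b * Xi * l) * (B * Xt * l) := by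
  have h1 : (1 + Z) * Λ - (Λ - l * B) * (1 - Z) = l * B := by
    rw [Matrix.add_mul, Matrix.mul_sub, hZ]; simp only [Matrix.one_mul, Matrix.mul_one]; abel
  have h2 : Xi * (Λ - l * B) = Λ * Xt - Xi * l * (B * Xt) := by
    have h3 : Xi * ((1 + Z) * Λ - (Λ - l * B) * (1 - Z)) * Xt = Xi * (l * B) * Xt := by rw [h1]
    rw [Matrix.mul_sub, Matrix.sub_mul, ← Matrix.mul_assoc Xi (1+Z), hX, Matrix.one_mul, Matrix.mul_assoc Xi (_ * _),
      Matrix.mul_assoc (Λ - l * B), hXt, Matrix.mul_one] at h3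
    simp only [Matrix.mul_assoc] at h3 ⊢
    rw [← h3]; abel
  have h4 : b * Λ = B + ζ • b := by
    rw [← hb, Matrix.mul_sub]; simp
  calc b * Xi * ((Λ - l * B) * l) = b * (Xi * (Λ - l * B)) * l := by simp only [Matrix.mul_assoc]
    _ = (b * Λ) * Xt * l - b * Xi * l * (B * Xt * l) := by
      rw [h2, Matrix.mul_sub, Matrix.sub_mul]; simp only [Matrix.mul_assoc]
    _ = _ := by
      rw [h4, Matrix.add_mul, Matrix.add_mul, Matrix.sub_mul, Matrix.one_mul]
      simp only [Matrix.smul_mul]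
      abel

lemma abs_double (Λ Z : Matrix n n ℂ) (l : Matrix n m ℂ) (B b c : Matrix m n ℂ)
    (Xi Xt : Matrix n n ℂ)
    (ξ η : ℂ) (hne : ξ ≠ η) (hZ : Z * Λ = -((Λ - l * B) * Z))
    (hb : b * (Λ - ξ • 1) = B) (hc : c * (Λ - η • 1) = B)
    (hX : Xi * (1 + Z) = 1) (hXt : (1 - Z) * Xt = 1) :
    (Z * ((Λ - ξ • 1) * (Λ - η • 1)) + (Λ - l * B - ξ • 1) * (Λ - l * B - η • 1)).det
      = (1 + Z).det * ((Λ - ξ • 1).det * (Λ - η • 1).det) *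
        (fromBlocks ((ξ / (ξ - η)) • (1 - b * Xt * l)) (1 - b * Xi * l)
          ((η / (ξ - η)) • (1 - c * Xt * l)) (1 - c * Xi * l)).det := by
  have hδ : ξ - η ≠ 0 := sub_ne_zero.mpr hne
  set M := Λ - l * B with hM
  set d := (ξ - η)⁻¹ with hd
  set W := B * Xt * l with hW
  have hX' : (1 + Z) * Xi = 1 := mul_eq_one_comm.mp hX
  have hbP : b * ((Λ - ξ • 1) * (Λ - η • 1)) = B * (Λ - η • 1) := by
    rw [← Matrix.mul_assoc, hb]
  have hcomm : (Λ - ξ • 1) * (Λ - η • 1) = (Λ - η • 1) * (Λ - ξ • 1) := by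
    simp only [Matrix.mul_sub, Matrix.sub_mul, Matrix.smul_mul, Matrix.mul_smul, Matrix.one_mul, Matrix.mul_one]; module
  have hcP : c * ((Λ - ξ • 1) * (Λ - η • 1)) = B * (Λ - ξ • 1) := by
    rw [hcomm, ← Matrix.mul_assoc, hc]
  let C : Matrix n (m ⊕ m) ℂ := fromCols (d • ((M - η • 1) * l)) (-(d • ((M - ξ • 1) * l)))
  let R : Matrix (m ⊕ m) n ℂ := fromRows b c
  have hCR : C * R * ((Λ - ξ • 1) * (Λ - η • 1))
      = (Λ - ξ • 1) * (Λ - η • 1) - (M - ξ • 1) * (M - η • 1) := by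
    have e1 : C * R = d • ((M - η • 1) * l) * b + (-(d • ((M - ξ • 1) * l))) * c :=
      fromCols_mul_fromRows _ _ _ _
    rw [e1, Matrix.add_mul, Matrix.mul_assoc, hbP, Matrix.mul_assoc, hcP]
    have e2 : (ξ - η) • (d • ((M - η • 1) * l) * (B * (Λ - η • 1)) + (-(d • ((M - ξ • 1) * l))) * (B * (Λ - ξ • 1)))
       = (ξ - η) • ((Λ - ξ • 1) * (Λ - η • 1) - (M - ξ • 1) * (M - η • 1)) := by
      rw [smul_add, Matrix.smul_mul, Matrix.neg_mul, Matrix.smul_mul, smul_neg, smul_smul, smul_smul, hd, mul_inv_cancel₀ hδ,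
        one_smul, one_smul]
      have e3 : ∀ u v : Matrix n n ℂ, u * l * (B * v) = u * (Λ - M) * v := by
        intro u v; rw [hM]; simp [Matrix.mul_assoc]
      rw [e3, e3]
      simp only [Matrix.mul_sub, Matrix.sub_mul, Matrix.smul_mul, Matrix.mul_smul, Matrix.one_mul, Matrix.mul_one, smul_sub, Matrix.mul_assoc]
      module
    exact smul_right_injective _ hδ e2
  have hfac : Z * ((Λ - ξ • 1) * (Λ - η • 1)) + (M - ξ • 1) * (M - η • 1)
      = (1 + Z) * (1 - (Xi * C) * R) * ((Λ - ξ • 1) * (Λ - η • 1)) := by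
    have e4 : (1 + Z) * (1 - (Xi * C) * R) = (1 + Z) - C * R := by
      rw [Matrix.mul_sub, Matrix.mul_one]
      simp only [← Matrix.mul_assoc]
      rw [hX', Matrix.one_mul]
    rw [e4, Matrix.sub_mul (1 + Z), hCR, Matrix.add_mul, Matrix.one_mul]; abel
  have rb := abs_row Λ Z l B b Xi Xt ξ hZ hb hX hXt
  have rc := abs_row Λ Z l B c Xi Xt η hZ hc hX hXt
  rw [← hM, ← hW] at rb rc
  have key : (1 : Matrix (m ⊕ m) (m ⊕ m) ℂ) - R * (Xi * C) =
     (fromBlocks ((ξ / (ξ - η)) • (1 - b * Xt * l)) (1 - b * Xi * l)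
          ((η / (ξ - η)) • (1 - c * Xt * l)) (1 - c * Xi * l)) *
      fromBlocks 1 (-1) (-(d • (η • 1 + W))) (d • (ξ • 1 + W)) := by
    have r1 : R * (Xi * C) = fromBlocks (b * Xi * (d • ((M - η • 1) * l))) (b * Xi * (-(d • ((M - ξ • 1) * l))))
       (c * Xi * (d • ((M - η • 1) * l))) (c * Xi * (-(d • ((M - ξ • 1) * l)))) := by
      rw [← Matrix.mul_assoc]
      simp only [R, C, fromRows_mul, mul_fromCols, fromCols_fromRows_eq_fromBlocks]
    have s : ∀ (a : Matrix m n ℂ) (z : ℂ), a * Xi * (d • ((M - z • 1) * l)) = d • (a * Xi * (M * l) - z • (a * Xi * l)) := by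
      intro a z
      rw [Matrix.sub_mul, Matrix.mul_smul, Matrix.mul_sub]; simp
    rw [r1, fromBlocks_multiply]
    simp only [Matrix.mul_neg, s, rb, rc]
    rw [← fromBlocks_one, sub_eq_add_neg, fromBlocks_neg, fromBlocks_add]
    have dd : d * ξ - d * η = 1 := by rw [← _root_.mul_sub, hd, inv_mul_cancel₀ hδ]
    have f1 : ξ / (ξ - η) = d * ξ := by rw [hd]; field_simp
    have f2 : η / (ξ - η) = d * η := by rw [hd]; field_simp
    have dd' : (1 : Matrix m m ℂ) = (d * ξ - d * η) • 1 := by rw [dd, one_smul]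
    rw [f1, f2]
    congr 1
    · simp only [Matrix.mul_smul, Matrix.mul_add, Matrix.mul_one, Matrix.sub_mul, Matrix.one_mul]
      linear_combination (norm := module) (1 : ℂ) • dd'
    · simp only [Matrix.mul_smul, Matrix.mul_add, Matrix.mul_one, Matrix.sub_mul, Matrix.one_mul]
      module
    · simp only [Matrix.mul_smul, Matrix.mul_add, Matrix.mul_one, Matrix.sub_mul, Matrix.one_mul]
      module
    · simp only [Matrix.mul_smul, Matrix.mul_add, Matrix.mul_one, Matrix.sub_mul, Matrix.one_mul]
      linear_combination (norm := module) (1 : ℂ) • dd'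
  have hE : (fromBlocks (1 : Matrix m m ℂ) (-1) (-(d • (η • 1 + W))) (d • (ξ • 1 + W))).det = 1 := by
    rw [det_fromBlocks_one₁₁]
    have : d • (ξ • 1 + W) - -(d • (η • 1 + W)) * -1 = (1 : Matrix m m ℂ) := by
      have dd : d * ξ - d * η = 1 := by rw [← _root_.mul_sub, hd, inv_mul_cancel₀ hδ]
      have dd' : (1 : Matrix m m ℂ) = (d * ξ - d * η) • 1 := by rw [dd, one_smul]
      rw [Matrix.mul_neg, Matrix.mul_one, dd']
      simp only [neg_neg, dd, one_smul, smul_add, smul_smul]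
      nth_rewrite 3 [dd']
      module
    rw [this, det_one]
  rw [hfac, det_mul, det_mul, Matrix.det_one_sub_mul_comm, key, det_mul, hE, det_mul]
  ring

end abstract_part

section abstract_part_two
variable {n m : Type*} [Fintype n] [DecidableEq n] [Fintype m] [DecidableEq m]

lemma abs_MZ (Λ Z M : Matrix n n ℂ) (ζ : ℂ) (hZ : Z * Λ = -(M * Z)) :
    (M - ζ • 1) * Z = -(Z * (Λ + ζ • 1)) := by
  rw [Matrix.mul_add, hZ, Matrix.sub_mul]
  simp only [Matrix.smul_mul, Matrix.mul_smul, Matrix.one_mul, Matrix.mul_one]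
  abel

lemma abs_comm (Λ : Matrix n n ℂ) (ξ η : ℂ) :
    (Λ + ξ • 1) * (Λ - η • 1) = (Λ - η • 1) * (Λ + ξ • 1) := by
  simp only [Matrix.mul_sub, Matrix.sub_mul, Matrix.mul_add, Matrix.add_mul, Matrix.smul_mul,
    Matrix.mul_smul, Matrix.one_mul, Matrix.mul_one]
  module

lemma abs_MY (Λ Z M D : Matrix n n ℂ) (ζ : ℂ) (hZ : Z * Λ = -(M * Z))
    (hD : (Λ + ζ • 1) * D = 1) :
    (M - ζ • 1) * (Z * (Λ - ζ • 1) * D) = -(Z * (Λ - ζ • 1)) := by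
  rw [← Matrix.mul_assoc, ← Matrix.mul_assoc, abs_MZ Λ Z M ζ hZ, Matrix.neg_mul, Matrix.neg_mul,
    Matrix.mul_assoc Z, abs_comm, Matrix.mul_assoc, Matrix.mul_assoc, hD, Matrix.mul_one]

/-- one shift -/
lemma abs_tau_one (Λ Z : Matrix n n ℂ) (l : Matrix n m ℂ) (B b : Matrix m n ℂ)
    (Xt D : Matrix n n ℂ) (ζ : ℂ) (hZ : Z * Λ = -((Λ - l * B) * Z))
    (hD : (Λ + ζ • 1) * D = 1) (hb : b * (Λ - ζ • 1) = B)
    (hdet : (Λ - ζ • 1).det ≠ 0)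
    (hXt : (1 - Z) * Xt = 1) :
    (1 - b * l).det * (1 + Z * (Λ - ζ • 1) * D).det = (1 - Z).det * (1 - b * Xt * l).det := by
  have e1 : (Λ - l * B - ζ • 1) * (1 + Z * (Λ - ζ • 1) * D) = (1 - Z) * (Λ - ζ • 1) - l * B := by
    rw [Matrix.mul_add, abs_MY Λ Z _ D ζ hZ hD, Matrix.sub_mul 1 Z, Matrix.mul_one, Matrix.one_mul]
    abel
  have e2 := congrArg Matrix.det e1
  rw [det_mul, abs_single Λ l B b (1 - Z) Xt ζ hb hXt] at e2
  have e3 := abs_single Λ l B b 1 1 ζ hb (by simp)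
  rw [Matrix.one_mul, Matrix.mul_one, det_one, one_mul, sub_right_comm] at e3
  rw [e3] at e2
  apply mul_right_cancel₀ hdet
  linear_combination e2

/-- two shifts -/
lemma abs_tau_two (Λ Z : Matrix n n ℂ) (l : Matrix n m ℂ) (B b c : Matrix m n ℂ)
    (Xi Xt D E : Matrix n n ℂ) (ξ η : ℂ) (hne : ξ ≠ η) (hZ : Z * Λ = -((Λ - l * B) * Z))
    (hD : (Λ + ξ • 1) * D = 1) (hE : (Λ + η • 1) * E = 1)
    (hb : b * (Λ - ξ • 1) = B) (hc : c * (Λ - η • 1) = B)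
    (hdet : (Λ - ξ • 1).det ≠ 0) (hdet' : (Λ - η • 1).det ≠ 0)
    (hX : Xi * (1 + Z) = 1) (hXt : (1 - Z) * Xt = 1) :
    (1 - b * l).det * (1 - c * l).det *
        (1 + Z * (Λ - ξ • 1) * D * (Λ - η • 1) * E).det
      = (1 + Z).det * (fromBlocks ((ξ / (ξ - η)) • (1 - b * Xt * l)) (1 - b * Xi * l)
          ((η / (ξ - η)) • (1 - c * Xt * l)) (1 - c * Xi * l)).det := by
  have hD' : D * (Λ + ξ • 1) = 1 := mul_eq_one_comm.mp hD
  have hcD : D * Λ = Λ * D := by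
    have h1 : D * ((Λ + ξ • 1) * Λ) * D = D * (Λ * (Λ + ξ • 1)) * D := by
      congr 2
      simp [Matrix.add_mul, Matrix.mul_add]
    rw [← Matrix.mul_assoc, hD', Matrix.one_mul, Matrix.mul_assoc, Matrix.mul_assoc, hD,
      Matrix.mul_one] at h1
    exact h1.symm
  set M := Λ - l * B with hM
  have hZ1 : Z * (Λ - ξ • 1) * D * Λ = -(M * (Z * (Λ - ξ • 1) * D)) := by
    have : Z * (Λ - ξ • 1) * D * Λ = (Z * Λ) * (Λ - ξ • 1) * D := by
      rw [Matrix.mul_assoc, hcD, Matrix.mul_assoc, Matrix.mul_assoc, Matrix.mul_assoc]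
      congr 1
      rw [← Matrix.mul_assoc, ← Matrix.mul_assoc]
      congr 1
      simp [Matrix.sub_mul, Matrix.mul_sub]
    rw [this, hZ]
    simp only [Matrix.neg_mul, Matrix.mul_assoc]
  have e1 : (M - ξ • 1) * (M - η • 1) * (1 + Z * (Λ - ξ • 1) * D * (Λ - η • 1) * E)
      = Z * ((Λ - ξ • 1) * (Λ - η • 1)) + (M - ξ • 1) * (M - η • 1) := by
    rw [Matrix.mul_add, Matrix.mul_one, Matrix.mul_assoc,
      abs_MY Λ (Z * (Λ - ξ • 1) * D) M E η hZ1 hE, Matrix.mul_neg, ← Matrix.mul_assoc,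
      abs_MY Λ Z M D ξ hZ hD, Matrix.neg_mul, neg_neg, Matrix.mul_assoc, add_comm]
  have e2 := congrArg Matrix.det e1
  rw [det_mul, det_mul, abs_double Λ Z l B b c Xi Xt ξ η hne hZ hb hc hX hXt] at e2
  have e3 := abs_single Λ l B b 1 1 ξ hb (by simp)
  have e4 := abs_single Λ l B c 1 1 η hc (by simp)
  rw [Matrix.one_mul, Matrix.mul_one, det_one, one_mul, sub_right_comm] at e3 e4
  rw [e3, e4] at e2
  apply mul_right_cancel₀ (mul_ne_zero hdet hdet')
  linear_combination e2

end abstract_part_two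

lemma det_four (x y p q r s p' q' r' s' : ℂ) :
    (fromBlocks (x • !![p, -q; r, s]) !![p, q; -r, s]
      (y • !![p', -q'; r', s']) !![p', q'; -r', s']).det
    = (x - y) ^ 2 * ((p * s + q * r) * (p' * s' + q' * r')) +
      4 * x * y * (p * q' - p' * q) * (r' * s - r * s') := by
  rw [← det_reindex_self finSumFinEquiv]
  simp only [det_succ_row_zero, Fin.sum_univ_succ]
  simp [Fin.succAbove, reindex_apply, finSumFinEquiv, Fin.addCases, fromBlocks]
  ring

section concrete
variable {N : ℕ}

noncomputable def cL (l₁ l₂ : Fin N → ℂ) : Matrix (Fin N ⊕ Fin N) (Fin N ⊕ Fin N) ℂ :=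
  fromBlocks (Dg l₂) 0 0 (-Dg l₁)
noncomputable def cZ (A₁ A₂ : Mat N) : Matrix (Fin N ⊕ Fin N) (Fin N ⊕ Fin N) ℂ :=
  fromBlocks 0 A₁ (-A₂) 0
noncomputable def cl (a b : Fin N → ℂ) : Matrix (Fin N ⊕ Fin N) (Fin 2) ℂ :=
  (Matrix.of ![Sum.elim a 0, Sum.elim 0 b])ᵀ
noncomputable def cB (a b : Fin N → ℂ) : Matrix (Fin 2) (Fin N ⊕ Fin N) ℂ :=
  Matrix.of ![Sum.elim a 0, Sum.elim 0 b]
noncomputable def cD (l₁ l₂ : Fin N → ℂ) (ζ : ℂ) : Matrix (Fin N ⊕ Fin N) (Fin N ⊕ Fin N) ℂ :=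
  fromBlocks (Dg l₂ + ζ • 1)⁻¹ 0 0 (-(Dg l₁ - ζ • 1)⁻¹)

lemma cL_sub (l₁ l₂ : Fin N → ℂ) (ζ : ℂ) :
    cL l₁ l₂ - ζ • 1 = fromBlocks (Dg l₂ - ζ • 1) 0 0 (-(Dg l₁ + ζ • 1)) := by
  rw [cL, ← fromBlocks_one, fromBlocks_smul, sub_eq_add_neg, fromBlocks_neg, fromBlocks_add]
  congr 1 <;> simp <;> abel

lemma cL_add (l₁ l₂ : Fin N → ℂ) (ζ : ℂ) :
    cL l₁ l₂ + ζ • 1 = fromBlocks (Dg l₂ + ζ • 1) 0 0 (-(Dg l₁ - ζ • 1)) := by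
  rw [cL, ← fromBlocks_one, fromBlocks_smul, fromBlocks_add]
  congr 1 <;> simp <;> abel

lemma cD_spec (l₁ l₂ : Fin N → ℂ) (ζ : ℂ) (h1 : IsUnit (Dg l₁ - ζ • (1 : Mat N)))
    (h4 : IsUnit (Dg l₂ + ζ • (1 : Mat N))) :
    (cL l₁ l₂ + ζ • 1) * cD l₁ l₂ ζ = 1 := by
  have h1' := (Matrix.isUnit_iff_isUnit_det _).mp h1
  have h4' := (Matrix.isUnit_iff_isUnit_det _).mp h4
  rw [cL_add, cD, fromBlocks_multiply, ← fromBlocks_one]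
  simp only [Matrix.mul_nonsing_inv _ h4', Matrix.neg_mul, Matrix.mul_neg, neg_neg,
    Matrix.mul_nonsing_inv _ h1', Matrix.mul_zero, Matrix.zero_mul, add_zero, zero_add, neg_zero]

lemma cL_det (l₁ l₂ : Fin N → ℂ) (ζ : ℂ) (h2 : IsUnit (Dg l₁ + ζ • (1 : Mat N)))
    (h3 : IsUnit (Dg l₂ - ζ • (1 : Mat N))) : (cL l₁ l₂ - ζ • 1).det ≠ 0 := by
  have h2' := ((Matrix.isUnit_iff_isUnit_det _).mp h2.neg).ne_zero
  have h3' := ((Matrix.isUnit_iff_isUnit_det _).mp h3).ne_zero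
  rw [cL_sub, det_fromBlocks_zero₂₁]
  exact mul_ne_zero h3' h2'

lemma cZ_shift (l₁ l₂ : Fin N → ℂ) (ζ : ℂ) (A₁ A₂ : Mat N) :
    cZ A₁ A₂ * (cL l₁ l₂ - ζ • 1) * cD l₁ l₂ ζ = cZ (shA₁ l₁ ζ A₁) (shA₂ l₂ ζ A₂) := by
  rw [cL_sub, cZ, cZ, cD, fromBlocks_multiply, fromBlocks_multiply, shA₁, shA₂]
  simp only [Matrix.neg_mul, Matrix.mul_neg, neg_neg, Matrix.mul_zero, Matrix.zero_mul, add_zero,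
    zero_add, neg_zero]

lemma cZ_add_one (A₁ A₂ : Mat N) : 1 + cZ A₁ A₂ = fromBlocks 1 A₁ (-A₂) 1 := by
  rw [cZ, ← fromBlocks_one, fromBlocks_add]; simp

lemma cZ_one_sub (A₁ A₂ : Mat N) : 1 - cZ A₁ A₂ = fromBlocks 1 (-A₁) A₂ 1 := by
  rw [cZ, ← fromBlocks_one, sub_eq_add_neg, fromBlocks_neg, fromBlocks_add]; simp

lemma cZ_det (A₁ A₂ : Mat N) : (1 + cZ A₁ A₂).det = tauD A₁ A₂ := by
  rw [cZ_add_one, det_fromBlocks_one₂₂, tauD]; simp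

lemma cZ_det' (A₁ A₂ : Mat N) : (1 - cZ A₁ A₂).det = tauD A₁ A₂ := by
  rw [cZ_one_sub, det_fromBlocks_one₂₂, tauD]; simp

lemma clB (a b c d : Fin N → ℂ) :
    cl a b * cB c d = fromBlocks (vecMulVec a c) 0 0 (vecMulVec b d) := by
  ext i j
  rcases i with i | i <;> rcases j with j | j <;>
    simp [cl, cB, Matrix.mul_apply, Fin.sum_univ_two, vecMulVec]

lemma cZL (l₁ l₂ ℓ₁ ℓ₂ β₁ β₂ : Fin N → ℂ) (A₁ A₂ : Mat N)
    (h1 : (Dg l₂ - Matrix.vecMulVec ℓ₁ β₁) * A₁ = A₁ * Dg l₁)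
    (h2 : (Dg l₁ - Matrix.vecMulVec ℓ₂ β₂) * A₂ = A₂ * Dg l₂) :
    cZ A₁ A₂ * cL l₁ l₂ = -((cL l₁ l₂ - cl ℓ₁ ℓ₂ * cB β₁ (-β₂)) * cZ A₁ A₂) := by
  rw [clB, cL, cZ, sub_eq_add_neg (fromBlocks _ _ _ _), fromBlocks_neg (vecMulVec ℓ₁ β₁),
    fromBlocks_add, fromBlocks_multiply, fromBlocks_multiply, fromBlocks_neg]
  have e : -Dg l₁ + -vecMulVec ℓ₂ (-β₂) = -(Dg l₁ - vecMulVec ℓ₂ β₂) := by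
    rw [vecMulVec_neg]; abel
  rw [← sub_eq_add_neg, e]
  congr 1
  · simp
  · simp [h1]
  · simp only [Matrix.neg_mul, Matrix.mul_neg, h2, Matrix.zero_mul, Matrix.mul_zero, zero_add,
      add_zero, neg_neg]
  · simp

lemma cb_spec (l₁ l₂ β₁ β₂ : Fin N → ℂ) (ζ : ℂ) (h2 : IsUnit (Dg l₁ + ζ • (1 : Mat N)))
    (h3 : IsUnit (Dg l₂ - ζ • (1 : Mat N))) :
    cB (β₁z l₂ β₁ ζ) (β₂z l₁ β₂ ζ) * (cL l₁ l₂ - ζ • 1) = cB β₁ (-β₂) := by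
  have h2' := (Matrix.isUnit_iff_isUnit_det _).mp h2
  have h3' := (Matrix.isUnit_iff_isUnit_det _).mp h3
  have e1 : β₁z l₂ β₁ ζ ᵥ* (Dg l₂ - ζ • (1 : Mat N)) = β₁ := by
    rw [β₁z, vecMul_vecMul, Matrix.nonsing_inv_mul _ h3', vecMul_one]
  have e2 : β₂z l₁ β₂ ζ ᵥ* (-(Dg l₁ + ζ • (1 : Mat N))) = -β₂ := by
    rw [vecMul_neg, β₂z, vecMul_vecMul, Matrix.nonsing_inv_mul _ h2', vecMul_one]
  rw [cL_sub]
  ext i j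
  rw [Matrix.mul_apply_eq_vecMul]
  fin_cases i
  · change (Sum.elim (β₁z l₂ β₁ ζ) 0 ᵥ* _) j = (Sum.elim β₁ 0 : Fin N ⊕ Fin N → ℂ) j
    rw [vecMul_fromBlocks]
    simp [e1]
  · change (Sum.elim 0 (β₂z l₁ β₂ ζ) ᵥ* _) j = (Sum.elim 0 (-β₂) : Fin N ⊕ Fin N → ℂ) j
    rw [vecMul_fromBlocks]
    rcases j with j | j
    · simp
    · simpa using congrFun e2 j

lemma cBMl (a b c d : Fin N → ℂ) (P Q R S : Mat N) :
    cB a b * fromBlocks P Q R S * cl c d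
      = !![a ⬝ᵥ (P *ᵥ c), a ⬝ᵥ (Q *ᵥ d); b ⬝ᵥ (R *ᵥ c), b ⬝ᵥ (S *ᵥ d)] := by
  have key : ∀ i j, (cB a b * fromBlocks P Q R S * cl c d) i j
      = cB a b i ⬝ᵥ (fromBlocks P Q R S *ᵥ (fun k => cl c d k j)) := by
    intro i j
    rw [Matrix.mul_assoc]; rfl
  ext i j
  rw [key]
  fin_cases i <;> fin_cases j
  · change Sum.elim a 0 ⬝ᵥ (_ *ᵥ Sum.elim c 0) = a ⬝ᵥ (P *ᵥ c)
    rw [fromBlocks_mulVec]; simp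
  · change Sum.elim a 0 ⬝ᵥ (_ *ᵥ Sum.elim 0 d) = a ⬝ᵥ (Q *ᵥ d)
    rw [fromBlocks_mulVec]; simp
  · change Sum.elim 0 b ⬝ᵥ (_ *ᵥ Sum.elim c 0) = b ⬝ᵥ (R *ᵥ c)
    rw [fromBlocks_mulVec]; simp
  · change Sum.elim 0 b ⬝ᵥ (_ *ᵥ Sum.elim 0 d) = b ⬝ᵥ (S *ᵥ d)
    rw [fromBlocks_mulVec]; simp

noncomputable def cXi (A₁ A₂ : Mat N) : Matrix (Fin N ⊕ Fin N) (Fin N ⊕ Fin N) ℂ :=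
  fromBlocks (G₁D A₁ A₂) (-(G₁D A₁ A₂ * A₁)) (G₂D A₁ A₂ * A₂) (G₂D A₁ A₂)
noncomputable def cXt (A₁ A₂ : Mat N) : Matrix (Fin N ⊕ Fin N) (Fin N ⊕ Fin N) ℂ :=
  fromBlocks (G₁D A₁ A₂) (G₁D A₁ A₂ * A₁) (-(G₂D A₁ A₂ * A₂)) (G₂D A₁ A₂)

lemma G_spec (A₁ A₂ : Mat N) (hG : IsUnit (1 + A₁ * A₂)) :
    G₁D A₁ A₂ + G₁D A₁ A₂ * A₁ * A₂ = 1 ∧ G₂D A₁ A₂ * A₂ * A₁ + G₂D A₁ A₂ = 1 := by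
  have h1 := (Matrix.isUnit_iff_isUnit_det _).mp hG
  have h2 : IsUnit (1 + A₂ * A₁).det := by
    rwa [Matrix.det_one_add_mul_comm] at h1
  have e1 := Matrix.nonsing_inv_mul _ h1
  have e2 := Matrix.nonsing_inv_mul _ h2
  rw [Matrix.mul_add, Matrix.mul_one, ← Matrix.mul_assoc] at e1 e2
  exact ⟨e1, by rw [add_comm]; exact e2⟩

lemma cXi_spec (A₁ A₂ : Mat N) (hG : IsUnit (1 + A₁ * A₂)) :
    cXi A₁ A₂ * (1 + cZ A₁ A₂) = 1 := by
  obtain ⟨e1, e2⟩ := G_spec A₁ A₂ hG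
  rw [cXi, cZ_add_one, fromBlocks_multiply, ← fromBlocks_one]
  congr 1
  · simpa using e1
  · simp
  · simp
  · simpa using e2

lemma cXt_spec (A₁ A₂ : Mat N) (hG : IsUnit (1 + A₁ * A₂)) :
    (1 - cZ A₁ A₂) * cXt A₁ A₂ = 1 := by
  obtain ⟨e1, e2⟩ := G_spec A₁ A₂ hG
  apply mul_eq_one_comm.mp
  rw [cXt, cZ_one_sub, fromBlocks_multiply, ← fromBlocks_one]
  congr 1
  · simpa using e1
  · simp
  · simp
  · simpa using e2

lemma cU (l₁ l₂ ℓ₁ ℓ₂ β₁ β₂ : Fin N → ℂ) (A₁ A₂ : Mat N) (ζ : ℂ) :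
    1 - cB (β₁z l₂ β₁ ζ) (β₂z l₁ β₂ ζ) * cXi A₁ A₂ * cl ℓ₁ ℓ₂
      = !![pz l₂ β₁ ℓ₁ ζ A₁ A₂, qz l₂ β₁ ℓ₂ ζ A₁ A₂;
          -rz l₁ β₂ ℓ₁ ζ A₁ A₂, sz l₁ β₂ ℓ₂ ζ A₁ A₂] := by
  rw [cXi, cBMl]
  ext i j
  fin_cases i <;> fin_cases j <;> simp [pz, qz, rz, sz, neg_mulVec, mulVec_mulVec]

lemma cUt (l₁ l₂ ℓ₁ ℓ₂ β₁ β₂ : Fin N → ℂ) (A₁ A₂ : Mat N) (ζ : ℂ) :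
    1 - cB (β₁z l₂ β₁ ζ) (β₂z l₁ β₂ ζ) * cXt A₁ A₂ * cl ℓ₁ ℓ₂
      = !![pz l₂ β₁ ℓ₁ ζ A₁ A₂, -qz l₂ β₁ ℓ₂ ζ A₁ A₂;
          rz l₁ β₂ ℓ₁ ζ A₁ A₂, sz l₁ β₂ ℓ₂ ζ A₁ A₂] := by
  rw [cXt, cBMl]
  ext i j
  fin_cases i <;> fin_cases j <;> simp [pz, qz, rz, sz, neg_mulVec, mulVec_mulVec]

lemma ckappa (a b c d : Fin N → ℂ) :
    (1 - cB a b * cl c d).det = (1 - a ⬝ᵥ c) * (1 - b ⬝ᵥ d) := by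
  have h := cBMl a b c d 1 0 0 1
  rw [fromBlocks_one, Matrix.mul_one] at h
  rw [h, det_fin_two]
  simp

end concrete

/-- the two-shift identity for the tau-functions:
`τ·τ^{ξη} − τ^ξ·τ^η = (4ξηK_ξK_η/(ξ−η)²)(p_ξq_η − p_ηq_ξ)(r_ηs_ξ − r_ξs_η)·τ²`. -/
theorem soliton_two_shift_tau {N : ℕ} (hN : 1 ≤ N)
    (l₁ l₂ ℓ₁ ℓ₂ β₁ β₂ : Fin N → ℂ) (A₁ A₂ : Mat N)
    (h1 : (Dg l₂ - Matrix.vecMulVec ℓ₁ β₁) * A₁ = A₁ * Dg l₁)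
    (h2 : (Dg l₁ - Matrix.vecMulVec ℓ₂ β₂) * A₂ = A₂ * Dg l₂)
    (hG : IsUnit (1 + A₁ * A₂))
    (ξ η : ℂ) (hξη : ξ ≠ η)
    (hξ1 : IsUnit (Dg l₁ - ξ • (1 : Mat N))) (hξ2 : IsUnit (Dg l₁ + ξ • (1 : Mat N)))
    (hξ3 : IsUnit (Dg l₂ - ξ • (1 : Mat N))) (hξ4 : IsUnit (Dg l₂ + ξ • (1 : Mat N)))
    (hη1 : IsUnit (Dg l₁ - η • (1 : Mat N))) (hη2 : IsUnit (Dg l₁ + η • (1 : Mat N)))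
    (hη3 : IsUnit (Dg l₂ - η • (1 : Mat N))) (hη4 : IsUnit (Dg l₂ + η • (1 : Mat N)))
    (hK1ξ : 1 - β₁z l₂ β₁ ξ ⬝ᵥ ℓ₁ ≠ 0) (hK2ξ : 1 - β₂z l₁ β₂ ξ ⬝ᵥ ℓ₂ ≠ 0)
    (hK1η : 1 - β₁z l₂ β₁ η ⬝ᵥ ℓ₁ ≠ 0) (hK2η : 1 - β₂z l₁ β₂ η ⬝ᵥ ℓ₂ ≠ 0) :
    tauD A₁ A₂ * tauD (shA₁ l₁ η (shA₁ l₁ ξ A₁)) (shA₂ l₂ η (shA₂ l₂ ξ A₂))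
      - tauD (shA₁ l₁ ξ A₁) (shA₂ l₂ ξ A₂) * tauD (shA₁ l₁ η A₁) (shA₂ l₂ η A₂)
      = (4 * ξ * η * Kz l₁ l₂ β₁ β₂ ℓ₁ ℓ₂ ξ * Kz l₁ l₂ β₁ β₂ ℓ₁ ℓ₂ η / (ξ - η) ^ 2) *
          (pz l₂ β₁ ℓ₁ ξ A₁ A₂ * qz l₂ β₁ ℓ₂ η A₁ A₂
            - pz l₂ β₁ ℓ₁ η A₁ A₂ * qz l₂ β₁ ℓ₂ ξ A₁ A₂) *
          (rz l₁ β₂ ℓ₁ η A₁ A₂ * sz l₁ β₂ ℓ₂ ξ A₁ A₂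
            - rz l₁ β₂ ℓ₁ ξ A₁ A₂ * sz l₁ β₂ ℓ₂ η A₁ A₂) *
          tauD A₁ A₂ ^ 2 := by
  have hZ := cZL l₁ l₂ ℓ₁ ℓ₂ β₁ β₂ A₁ A₂ h1 h2
  have hbξ := cb_spec l₁ l₂ β₁ β₂ ξ hξ2 hξ3
  have hbη := cb_spec l₁ l₂ β₁ β₂ η hη2 hη3
  have hDξ := cD_spec l₁ l₂ ξ hξ1 hξ4
  have hDη := cD_spec l₁ l₂ η hη1 hη4
  have hdξ := cL_det l₁ l₂ ξ hξ2 hξ3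
  have hdη := cL_det l₁ l₂ η hη2 hη3
  have hXi := cXi_spec A₁ A₂ hG
  have hXt := cXt_spec A₁ A₂ hG
  have t1 := abs_tau_one _ _ _ _ _ _ _ ξ hZ hDξ hbξ hdξ hXt
  have t2 := abs_tau_one _ _ _ _ _ _ _ η hZ hDη hbη hdη hXt
  have t3 := abs_tau_two _ _ _ _ _ _ _ _ _ _ ξ η hξη hZ hDξ hDη hbξ hbη hdξ hdη hXi hXt
  rw [ckappa, cZ_shift, cZ_det, cZ_det', cUt, det_fin_two_of] at t1 t2
  rw [ckappa, ckappa, cZ_shift, cZ_shift, cZ_det, cZ_det, cUt, cUt, cU, cU, det_four] at t3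
  simp only [Kz, K₁z, K₂z]
  have hδ : ξ - η ≠ 0 := sub_ne_zero.mpr hξη
  generalize 1 - β₁z l₂ β₁ ξ ⬝ᵥ ℓ₁ = a at *
  generalize 1 - β₂z l₁ β₂ ξ ⬝ᵥ ℓ₂ = b at *
  generalize 1 - β₁z l₂ β₁ η ⬝ᵥ ℓ₁ = c at *
  generalize 1 - β₂z l₁ β₂ η ⬝ᵥ ℓ₂ = d at *
  generalize tauD (shA₁ l₁ η (shA₁ l₁ ξ A₁)) (shA₂ l₂ η (shA₂ l₂ ξ A₂)) = T3 at *
  generalize tauD (shA₁ l₁ ξ A₁) (shA₂ l₂ ξ A₂) = T1 at *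
  generalize tauD (shA₁ l₁ η A₁) (shA₂ l₂ η A₂) = T2 at *
  generalize tauD A₁ A₂ = T at *
  generalize pz l₂ β₁ ℓ₁ ξ A₁ A₂ = p at *
  generalize qz l₂ β₁ ℓ₂ ξ A₁ A₂ = q at *
  generalize rz l₁ β₂ ℓ₁ ξ A₁ A₂ = r at *
  generalize sz l₁ β₂ ℓ₂ ξ A₁ A₂ = s at *
  generalize pz l₂ β₁ ℓ₁ η A₁ A₂ = p' at *
  generalize qz l₂ β₁ ℓ₂ η A₁ A₂ = q' at *
  generalize rz l₁ β₂ ℓ₁ η A₁ A₂ = r' at *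
  generalize sz l₁ β₂ ℓ₂ η A₁ A₂ = s' at *
  have e : ξ / (ξ - η) - η / (ξ - η) = 1 := by rw [← sub_div, div_self hδ]
  rw [e] at t3
  have hk : a * b * (c * d) ≠ 0 := by simp [hK1ξ, hK2ξ, hK1η, hK2η]
  apply mul_left_cancel₀ hk
  have hR : a * b * (c * d) * (4 * ξ * η * (a⁻¹ * b⁻¹) * (c⁻¹ * d⁻¹) / (ξ - η) ^ 2 *
      (p * q' - p' * q) * (r' * s - r * s') * T ^ 2)
      = 4 * (ξ / (ξ - η)) * (η / (ξ - η)) * (p * q' - p' * q) * (r' * s - r * s') * T ^ 2 := by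
    field_simp
  rw [hR]
  linear_combination T * t3 - c * d * T2 * t1 - T * (p * s + q * r) * t2
end
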